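/- Let V be a Banach 𝕆-bimodule, T a power-associative bounded right para-linear operator on V, m ∈ ℕ, and U ⊆ 𝕆 a T-left-admissible (respectively T-right-admissible) domain. Then for every J ∈ 𝕊, with ds_J := −ds·J: (1/2π) ∫_{∂(U∩ℂ_J)} (R_s − T)^{⊚−} ⊙ (ds_J · s^m) = T^m, and respectively (1/2π) ∫_{∂(U∩ℂ_J)} (s^m · ds_J) ⊙ (R_s − T)^{−⊚} = T^m. -/

import Mathlib

noncomputable section

open scoped BigOperators

/-- Octonions, realized via the Cayley–Dickson doubling of the quaternions. -/
@[ext]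
structure Oct : Type where
  a : Quaternion ℝ
  b : Quaternion ℝ

namespace Oct

instance : Zero Oct := ⟨⟨0, 0⟩⟩
instance : Add Oct := ⟨fun x y => ⟨x.a + y.a, x.b + y.b⟩⟩
instance : Neg Oct := ⟨fun x => ⟨-x.a, -x.b⟩⟩
instance : Sub Oct := ⟨fun x y => ⟨x.a - y.a, x.b - y.b⟩⟩
instance : SMul ℕ Oct := ⟨fun n x => ⟨n • x.a, n • x.b⟩⟩
instance : SMul ℤ Oct := ⟨fun n x => ⟨n • x.a, n • x.b⟩⟩
instance : SMul ℝ Oct := ⟨fun r x => ⟨r • x.a, r • x.b⟩⟩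

def toLp (x : Oct) : WithLp 2 (Quaternion ℝ × Quaternion ℝ) :=
  (WithLp.equiv 2 (Quaternion ℝ × Quaternion ℝ)).symm (x.a, x.b)

lemma toLp_injective : Function.Injective toLp := by
  rintro ⟨xa, xb⟩ ⟨ya, yb⟩ h
  have ha : xa = ya :=
    congrArg (fun z => (WithLp.equiv 2 (Quaternion ℝ × Quaternion ℝ) z).1) h
  have hb : xb = yb :=
    congrArg (fun z => (WithLp.equiv 2 (Quaternion ℝ × Quaternion ℝ) z).2) h
  subst ha; subst hb; rfl

instance : AddCommGroup Oct :=
  toLp_injective.addCommGroup toLp rfl (fun _ _ => rfl) (fun _ => rfl) (fun _ _ => rfl)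
    (fun _ _ => rfl) (fun _ _ => rfl)

def toLpHom : Oct →+ WithLp 2 (Quaternion ℝ × Quaternion ℝ) where
  toFun := toLp
  map_zero' := rfl
  map_add' _ _ := rfl

instance : Module ℝ Oct := toLp_injective.module ℝ toLpHom fun _ _ => rfl

instance : NormedAddCommGroup Oct :=
  NormedAddCommGroup.induced Oct (WithLp 2 (Quaternion ℝ × Quaternion ℝ)) toLpHom toLp_injective

instance : NormedSpace ℝ Oct := ⟨fun r x => norm_smul_le r (toLp x)⟩

def toProdLin : Oct →ₗ[ℝ] Quaternion ℝ × Quaternion ℝ where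
  toFun x := (x.a, x.b)
  map_add' _ _ := rfl
  map_smul' _ _ := rfl

lemma toProdLin_injective : Function.Injective toProdLin := by
  rintro ⟨xa, xb⟩ ⟨ya, yb⟩ h
  have ha : xa = ya := congrArg Prod.fst h
  have hb : xb = yb := congrArg Prod.snd h
  subst ha; subst hb; rfl

instance : FiniteDimensional ℝ Oct :=
  FiniteDimensional.of_injective toProdLin toProdLin_injective

instance : CompleteSpace Oct := FiniteDimensional.complete ℝ Oct

instance : One Oct := ⟨⟨1, 0⟩⟩

instance : Mul Oct :=
  ⟨fun x y => ⟨x.a * y.a - star y.b * x.b, y.b * x.a + x.b * star y.a⟩⟩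

/-- Octonionic conjugation. -/
def conj (x : Oct) : Oct := ⟨star x.a, -x.b⟩

/-- The real part of an octonion. -/
def re (x : Oct) : ℝ := x.a.re

/-- Powers of an octonion (association chosen on the left factor). -/
def opow (s : Oct) : ℕ → Oct
  | 0 => 1
  | n + 1 => s * opow s n

/-- The inverse of a nonzero octonion. -/
def oinv (s : Oct) : Oct := (‖s‖ ^ 2)⁻¹ • conj s

/-- `invPow s n` is the octonion `s ^ (-1 - n)`. -/
def invPow (s : Oct) (n : ℕ) : Oct := opow (oinv s) (n + 1)

def eNat : ℕ → Oct
  | 0 => ⟨1, 0⟩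
  | 1 => ⟨⟨0, 1, 0, 0⟩, 0⟩
  | 2 => ⟨⟨0, 0, 1, 0⟩, 0⟩
  | 3 => ⟨⟨0, 0, 0, 1⟩, 0⟩
  | 4 => ⟨0, 1⟩
  | 5 => ⟨0, ⟨0, 1, 0, 0⟩⟩
  | 6 => ⟨0, ⟨0, 0, 1, 0⟩⟩
  | 7 => ⟨0, ⟨0, 0, 0, 1⟩⟩
  | _ => 0

/-- The standard basis `e_0 = 1, e_1, …, e_7` of the octonions. -/
def e (i : Fin 8) : Oct := eNat i.val

/-- The six-dimensional sphere `𝕊` of imaginary units of `𝕆`. -/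
def unitSphere : Set Oct := {J | J * J = -1}

/-- The slice `ℂ_J = ℝ ⊕ ℝJ` of the octonions. -/
def sliceC (J : Oct) : Set Oct := {s | ∃ x y : ℝ, s = x • (1 : Oct) + y • J}

/-- The embedding of `ℂ` onto the slice `ℂ_J`, `x + y i ↦ x + y J`. -/
def toSlice (J : Oct) (z : ℂ) : Oct := z.re • (1 : Oct) + z.im • J

end Oct

open Oct

/-- A (normed/Banach) `𝕆`-bimodule: a real normed space with continuous real-bilinear left and
right octonionic multiplications satisfying the alternativity relations
`[p,q,x] = [q,x,p] = [x,p,q] = -[q,p,x]` and the norm identities `‖px‖ = |p|‖x‖ = ‖xp‖`. -/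
class OctBimodule (V : Type*) [NormedAddCommGroup V] [NormedSpace ℝ V] : Type _ where
  lm : Oct →ₗ[ℝ] V →L[ℝ] V
  rm : Oct →ₗ[ℝ] V →L[ℝ] V
  lm_one : ∀ x : V, lm 1 x = x
  rm_one : ∀ x : V, rm 1 x = x
  /-- `[p,q,x] = [q,x,p]` -/
  assoc_cyc₁ : ∀ (p q : Oct) (x : V),
    lm (p * q) x - lm p (lm q x) = rm p (lm q x) - lm q (rm p x)
  /-- `[p,q,x] = [x,p,q]` -/
  assoc_cyc₂ : ∀ (p q : Oct) (x : V),
    lm (p * q) x - lm p (lm q x) = rm q (rm p x) - rm (p * q) x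
  /-- `[p,q,x] = -[q,p,x]` -/
  assoc_alt : ∀ (p q : Oct) (x : V),
    lm (p * q) x - lm p (lm q x) = -(lm (q * p) x - lm q (lm p x))
  norm_lm : ∀ (p : Oct) (x : V), ‖lm p x‖ = ‖p‖ * ‖x‖
  norm_rm : ∀ (p : Oct) (x : V), ‖rm p x‖ = ‖p‖ * ‖x‖

section OctMod

variable {V : Type*} [NormedAddCommGroup V] [NormedSpace ℝ V] [OctBimodule V]

/-- Left multiplication `x ↦ p x` as a bounded real-linear operator. -/
def lmo (p : Oct) : V →L[ℝ] V := OctBimodule.lm p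

/-- Right multiplication `R_p : x ↦ x p` as a bounded real-linear operator. -/
def rmo (p : Oct) : V →L[ℝ] V := OctBimodule.rm p

variable (V)

/-- The real-part projection `Re x = (5/12) x - (1/12) ∑_{i=1}^7 e_i x e_i` of an
`𝕆`-bimodule. -/
def reO : V →L[ℝ] V :=
  (5 / 12 : ℝ) • ContinuousLinearMap.id ℝ V -
    (1 / 12 : ℝ) • ∑ i : Fin 7, (rmo (e i.succ)).comp (lmo (e i.succ))

/-- The real part `Re V` of an `𝕆`-bimodule, i.e. the set of associative central elements. -/
def ReSet : Set V :=
  {m | (∀ p q : Oct, lmo (p * q) m = lmo p (lmo q m)) ∧ ∀ p : Oct, lmo p m = rmo p m}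

/-- The slice `ℂ_J(V) = Re V ⊕ J · Re V` of an `𝕆`-bimodule. -/
def CJV (J : Oct) : Set V :=
  {x | ∃ u ∈ ReSet V, ∃ w ∈ ReSet V, x = u + lmo J w}

/-- The slice projection `π_J(x) = Re x + J Re (J̄ x)`. -/
def piJ (J : Oct) : V →L[ℝ] V :=
  reO V + (lmo J).comp ((reO V).comp (lmo (Oct.conj J)))

variable {V}

/-- The second right associator `B_p(T, x) = T(x) p - T(x p)` of an operator. -/
def Bop (p : Oct) (T : V →L[ℝ] V) : V →L[ℝ] V := (rmo p).comp T - T.comp (rmo p)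

/-- A bounded real-linear operator is right (octonionic) para-linear if `Re B_p(T,x) = 0`. -/
def IsRightPara (T : V →L[ℝ] V) : Prop := ∀ (p : Oct) (x : V), reO V (Bop p T x) = 0

/-- The left octonionic scalar multiplication `(p ⊙ T)(x) = p T(x) + B_p(T,x)` on operators. -/
def odotL (p : Oct) (T : V →L[ℝ] V) : V →L[ℝ] V := (lmo p).comp T + Bop p T

/-- The right octonionic scalar multiplication `(T ⊙ p)(x) = T(p x) - B_p(T,x)` on operators. -/
def odotR (T : V →L[ℝ] V) (p : Oct) : V →L[ℝ] V := T.comp (lmo p) - Bop p T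

/-- The lifting map, `(lif F)(x) = ∑_i F(x ē_i) e_i`. -/
def lifO (F : V →L[ℝ] V) : V →L[ℝ] V :=
  ∑ i : Fin 8, (rmo (e i)).comp (F.comp (rmo (Oct.conj (e i))))

/-- The extension map, `(ext G)(∑ x_i e_i) = ∑ G(x_i) e_i`, where `x_i = Re (x ē_i)`. -/
def extO (G : V →L[ℝ] V) : V →L[ℝ] V :=
  ∑ i : Fin 8, (rmo (e i)).comp (G.comp ((reO V).comp (rmo (Oct.conj (e i)))))

/-- The left regular power `T^{n⊚} = lif (Re ∘ Tⁿ)`. -/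
def rpowL (T : V →L[ℝ] V) (n : ℕ) : V →L[ℝ] V := lifO ((reO V).comp (T ^ n))

/-- The right regular power `T^{⊚n} = ext (Tⁿ|_{Re V})`. -/
def rpowR (T : V →L[ℝ] V) (n : ℕ) : V →L[ℝ] V := extO (T ^ n)

/-- The regular composition `f ⊚ g = lif (Re ∘ f ∘ g)`. -/
def rcomp (f g : V →L[ℝ] V) : V →L[ℝ] V := lifO ((reO V).comp (f.comp g))

/-- The composition associator `[f,g,x]_⊚ = (f ⊚ g)(x) - f(g(x))`. -/
def compAssoc (f g : V →L[ℝ] V) (x : V) : V := rcomp f g x - f (g x)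

/-- The right regular inverse `T^{⊚-} = ext (T⁻¹|_{Re V})` of an invertible operator. -/
def rinvR (T : V →L[ℝ] V) : V →L[ℝ] V := extO (Ring.inverse T)

/-- The left regular inverse `T^{-⊚} = lif (Re ∘ T⁻¹)` of an invertible operator. -/
def rinvL (T : V →L[ℝ] V) : V →L[ℝ] V := lifO ((reO V).comp (Ring.inverse T))

/-- An operator is power-associative if all of its (composition) powers are right
para-linear. -/
def IsPowerAssoc (T : V →L[ℝ] V) : Prop := ∀ n : ℕ, IsRightPara (T ^ n)

/-- A bounded operator is octonionic linear if `T(xp) = T(x)p` for all `p`. -/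
def IsOctLinear (T : V →L[ℝ] V) : Prop := ∀ (p : Oct) (x : V), T (rmo p x) = rmo p (T x)

/-- `S` is `ℂ_J`-extendable power associative: `Sⁿ(v s) = Sⁿ(v) s` for `v ∈ Re V`,
`s ∈ ℂ_J`, `n ≥ 1`. -/
def CJExtPA (J : Oct) (S : V →L[ℝ] V) : Prop :=
  ∀ n : ℕ, 1 ≤ n → ∀ v ∈ ReSet V, ∀ s ∈ sliceC J, (S ^ n) (rmo s v) = rmo s ((S ^ n) v)

/-- `S` is `ℂ_J`-liftable power associative: `Re (Sⁿ(v s)) = Re (Sⁿ(v) s)` for all `v ∈ V`,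
`s ∈ ℂ_J`, `n ≥ 1`. -/
def CJLiftPA (J : Oct) (S : V →L[ℝ] V) : Prop :=
  ∀ n : ℕ, 1 ≤ n → ∀ (v : V), ∀ s ∈ sliceC J,
    reO V ((S ^ n) (rmo s v)) = reO V (rmo s ((S ^ n) v))

/-- The pull-back slice-resolvent set `ρ*_J(T)`. -/
def pbResSlice (T : V →L[ℝ] V) (J : Oct) : Set Oct :=
  {s | s ∈ sliceC J ∧ IsUnit ((rmo s : V →L[ℝ] V) - T) ∧
    CJExtPA J (Ring.inverse ((rmo s : V →L[ℝ] V) - T))}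

/-- The pull-back resolvent set `ρ*(T)`. -/
def pbRes (T : V →L[ℝ] V) : Set Oct := ⋃ J ∈ unitSphere, pbResSlice T J

/-- The pull-back spectrum `σ*(T) = 𝕆 ∖ ρ*(T)`. -/
def pbSpec (T : V →L[ℝ] V) : Set Oct := Set.univ \ pbRes T

/-- The push-forward slice-resolvent set `ρ_{*J}(T)`. -/
def pfResSlice (T : V →L[ℝ] V) (J : Oct) : Set Oct :=
  {s | s ∈ sliceC J ∧ IsUnit ((rmo s : V →L[ℝ] V) - T) ∧
    CJLiftPA J (Ring.inverse ((rmo s : V →L[ℝ] V) - T))}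

/-- The push-forward resolvent set `ρ_*(T)`. -/
def pfRes (T : V →L[ℝ] V) : Set Oct := ⋃ J ∈ unitSphere, pfResSlice T J

/-- The push-forward spectrum `σ_*(T) = 𝕆 ∖ ρ_*(T)`. -/
def pfSpec (T : V →L[ℝ] V) : Set Oct := Set.univ \ pfRes T

/-- The real-part projection of the `𝕆`-bimodule `𝓑_RO(V)` of bounded right para-linear
operators, given by `Re A = (5/12) A - (1/12) ∑_{i=1}^7 (e_i ⊙ A) ⊙ e_i`. -/
def reOpB (A : V →L[ℝ] V) : V →L[ℝ] V :=
  (5 / 12 : ℝ) • A - (1 / 12 : ℝ) • ∑ i : Fin 7, odotR (odotL (e i.succ) A) (e i.succ)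

end OctMod

/-- A set `U ⊆ 𝕆` is slice-open if `U ∩ ℂ_J` is open in `ℂ_J` for every `J ∈ 𝕊`. -/
def SliceOpen (U : Set Oct) : Prop :=
  ∀ J ∈ unitSphere, IsOpen (Oct.toSlice J ⁻¹' U)

/-- A parametrization of the boundary `∂(U ∩ ℂ_J)` by finitely many continuously
differentiable, positively oriented Jordan curves (positivity of the orientation is encoded
through the winding numbers). -/
structure SliceContour (J : Oct) (U : Set Oct) where
  n : ℕ
  γ : Fin n → ℝ → ℂ
  smooth : ∀ i, ContDiff ℝ 1 (γ i)
  closed : ∀ i, γ i 0 = γ i 1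
  jordan : ∀ i, Set.InjOn (γ i) (Set.Ico (0 : ℝ) 1)
  image_eq : (⋃ i, γ i '' Set.Icc (0 : ℝ) 1) = frontier (Oct.toSlice J ⁻¹' U)
  winding_inside : ∀ z : ℂ, Oct.toSlice J z ∈ U →
    (∑ i, ∫ t in (0 : ℝ)..1, deriv (γ i) t / (γ i t - z)) = 2 * (Real.pi : ℂ) * Complex.I
  winding_outside : ∀ z : ℂ, Oct.toSlice J z ∉ closure U →
    (∑ i, ∫ t in (0 : ℝ)..1, deriv (γ i) t / (γ i t - z)) = 0

/-- The integral `∫_{∂(U ∩ ℂ_J)} Φ(s, ds)` along a slice contour: the integrand gets the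
point of the curve and its derivative (both in the coordinates of the slice). -/
def contourSum {J : Oct} {U : Set Oct} (Γ : SliceContour J U) {E : Type*}
    [NormedAddCommGroup E] [NormedSpace ℝ E] (Φ : ℂ → ℂ → E) : E :=
  ∑ i, ∫ t in (0 : ℝ)..1, Φ (Γ.γ i t) (deriv (Γ.γ i) t)

/-- An axially symmetric slice domain (s-domain) in `𝕆`. -/
structure IsAdmissibleDomain (U : Set Oct) : Prop where
  isOpen : IsOpen U
  isConnected : IsConnected U
  real_nonempty : (U ∩ {s : Oct | ∃ r : ℝ, s = r • (1 : Oct)}).Nonempty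
  axially : ∀ (z : ℂ), ∀ I ∈ unitSphere, ∀ J ∈ unitSphere,
    Oct.toSlice I z ∈ U → Oct.toSlice J z ∈ U
  slice_conn : ∀ J ∈ unitSphere, IsConnected (Oct.toSlice J ⁻¹' U)

section Adm

variable {V : Type*} [NormedAddCommGroup V] [NormedSpace ℝ V] [OctBimodule V]

/-- A `T`-left-admissible domain: an axially symmetric s-domain containing the pull-back
spectrum `σ*(T)`.  (The regularity of its slice boundaries is witnessed by the slice
contours used in the integrals.) -/
def LeftAdmissible (T : V →L[ℝ] V) (U : Set Oct) : Prop :=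
  IsAdmissibleDomain U ∧ pbSpec T ⊆ U

/-- A `T`-right-admissible domain: an axially symmetric s-domain containing the push-forward
spectrum `σ_*(T)`. -/
def RightAdmissible (T : V →L[ℝ] V) (U : Set Oct) : Prop :=
  IsAdmissibleDomain U ∧ pfSpec T ⊆ U

end Adm

/-- The axially symmetric set `Ω_D ⊆ 𝕆` induced by a conjugation-invariant set `D ⊆ ℂ`. -/
def OmegaD (D : Set ℂ) : Set Oct := ⋃ J ∈ unitSphere, Oct.toSlice J '' D

/-- `F` is the stem of a slice preserving slice regular function on `Ω_D`: it is holomorphic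
on the open conjugation-invariant set `D` and intertwines complex conjugation. -/
structure IsStem (D : Set ℂ) (F : ℂ → ℂ) : Prop where
  isOpen : IsOpen D
  conj_mem : ∀ z ∈ D, (starRingEnd ℂ) z ∈ D
  holo : DifferentiableOn ℂ F D
  conj_comm : ∀ z ∈ D, F ((starRingEnd ℂ) z) = (starRingEnd ℂ) (F z)

section FC

variable {V : Type*} [NormedAddCommGroup V] [NormedSpace ℝ V] [OctBimodule V]

/-- The slice integral `(1/2π) ∫_{∂(U∩ℂ_J)} (R_s - T)^{⊚-} ⊙ (ds_J f(s))` defining the left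
slice regular functional calculus of a slice preserving function with stem `F`. -/
def leftFC (T : V →L[ℝ] V) (J : Oct) {U : Set Oct} (Γ : SliceContour J U)
    (F : ℂ → ℂ) : V →L[ℝ] V :=
  (2 * Real.pi)⁻¹ • contourSum Γ fun z dz =>
    odotR (rinvR ((rmo (Oct.toSlice J z) : V →L[ℝ] V) - T))
      ((-(Oct.toSlice J dz) * J) * Oct.toSlice J (F z))

/-- The slice integral `(1/2π) ∫_{∂(U∩ℂ_J)} (f(s) ds_J) ⊙ (R_s - T)^{-⊚}` defining the right
slice regular functional calculus of a slice preserving function with stem `F`. -/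
def rightFC (T : V →L[ℝ] V) (J : Oct) {U : Set Oct} (Γ : SliceContour J U)
    (F : ℂ → ℂ) : V →L[ℝ] V :=
  (2 * Real.pi)⁻¹ • contourSum Γ fun z dz =>
    odotL (Oct.toSlice J (F z) * (-(Oct.toSlice J dz) * J))
      (rinvL ((rmo (Oct.toSlice J z) : V →L[ℝ] V) - T))

end FC

/-- The family of stems of the components, relative to `J = ∑ c_i e_i`, of a function of the
form `f₀ + f₁ • J` with `f₀, f₁` slice preserving with stems `F₀, F₁`. -/
def stemFamily (c : Fin 8 → ℝ) (F₀ F₁ : ℂ → ℂ) : Fin 8 → ℂ → ℂ :=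
  fun i z => if i = 0 then F₀ z else (c i : ℂ) * F₁ z

namespace Oct

/-- Left multiplication by an octonion, as a real-linear map. -/
def lmulLin (q : Oct) : Oct →ₗ[ℝ] Oct where
  toFun x := q * x
  map_add' x y := by
    refine Oct.ext ?_ ?_
    · show q.a * (x.a + y.a) - star (x.b + y.b) * q.b =
        (q.a * x.a - star x.b * q.b) + (q.a * y.a - star y.b * q.b)
      rw [mul_add, star_add, add_mul]; abel
    · show (x.b + y.b) * q.a + q.b * star (x.a + y.a) =
        (x.b * q.a + q.b * star x.a) + (y.b * q.a + q.b * star y.a)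
      rw [add_mul, star_add, mul_add]; abel
  map_smul' r x := by
    refine Oct.ext ?_ ?_
    · show q.a * (r • x.a) - star (r • x.b) * q.b = r • (q.a * x.a - star x.b * q.b)
      rw [mul_smul_comm, Quaternion.star_smul, smul_mul_assoc, smul_sub]
    · show (r • x.b) * q.a + q.b * star (r • x.a) = r • (x.b * q.a + q.b * star x.a)
      rw [smul_mul_assoc, Quaternion.star_smul, mul_smul_comm, smul_add]

/-- Left multiplication `L_q : x ↦ q x` as a bounded real-linear operator on `𝕆`. -/
def Lq (q : Oct) : Oct →L[ℝ] Oct := (lmulLin q).toContinuousLinearMap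

/-- The two-sphere `[q] = {Re q + |Im q| J : J ∈ 𝕊}` associated with an octonion `q`. -/
def qSphere (q : Oct) : Set Oct :=
  {s | ∃ J ∈ unitSphere, s = Oct.re q • (1 : Oct) + ‖q - Oct.re q • (1 : Oct)‖ • J}

end Oct

section Cauchy

open Set Filter Metric
open scoped Topology

/-- Differentiation under the integral sign for a bounded family of holomorphic functions. -/
lemma hasDerivAt_integral_of_bounded_holomorphic {g : ℂ → ℝ → ℂ} {z₀ : ℂ} {r M : ℝ} (hr : 0 < r)
    (hd : ∀ t ∈ Icc (0 : ℝ) 1, DifferentiableOn ℂ (fun z => g z t) (ball z₀ r))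
    (hb : ∀ t ∈ Icc (0 : ℝ) 1, ∀ z ∈ ball z₀ r, ‖g z t‖ ≤ M)
    (hc : ∀ z ∈ ball z₀ r, ContinuousOn (g z) (Icc 0 1)) :
    HasDerivAt (fun z => ∫ t in (0 : ℝ)..1, g z t)
      (∫ t in (0 : ℝ)..1, deriv (fun z => g z t) z₀) z₀ := by
  have hmeas : ∀ z ∈ ball z₀ r, MeasureTheory.AEStronglyMeasurable (g z)
      (MeasureTheory.volume.restrict (uIoc (0 : ℝ) 1)) := fun z hz => by
    rw [uIoc_of_le zero_le_one]
    exact ((hc z hz).mono Ioc_subset_Icc_self).aestronglyMeasurable measurableSet_Ioc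
  have hz₀ : z₀ ∈ ball z₀ r := mem_ball_self hr
  have hIcc : ∀ t ∈ uIoc (0 : ℝ) 1, t ∈ Icc (0 : ℝ) 1 := fun t ht => by
    rw [uIoc_of_le zero_le_one] at ht
    exact Ioc_subset_Icc_self ht
  have hderiv : ∀ t ∈ Icc (0 : ℝ) 1, ∀ z ∈ ball z₀ r,
      HasDerivAt (fun z => g z t) (deriv (fun z => g z t) z) z := fun t ht z hz =>
    ((hd t ht).differentiableAt (isOpen_ball.mem_nhds hz)).hasDerivAt
  refine (intervalIntegral.hasDerivAt_integral_of_dominated_loc_of_deriv_le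
    (F' := fun z t => deriv (fun z => g z t) z) (s := ball z₀ (r / 2))
    (bound := fun _ => M / (r / 4)) (ball_mem_nhds _ (by positivity)) ?_ ?_ ?_ ?_ ?_ ?_).2
  · filter_upwards [ball_mem_nhds z₀ hr] with z hz using hmeas z hz
  · exact (by simpa using hc z₀ hz₀ : ContinuousOn _ (uIcc (0 : ℝ) 1)).intervalIntegrable
  · have hu : Tendsto (fun n : ℕ => z₀ + ((r / (n + 2) : ℝ) : ℂ)) atTop (𝓝[≠] z₀) := by
      refine tendsto_nhdsWithin_iff.2 ⟨?_, .of_forall fun n => ?_⟩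
      · have h : Tendsto (fun n : ℕ => r / ((n : ℝ) + 2)) atTop (𝓝 0) :=
          tendsto_const_nhds.div_atTop
            (tendsto_atTop_add_const_right _ _ tendsto_natCast_atTop_atTop)
        have h2 := ((Complex.continuous_ofReal.tendsto 0).comp h).const_add z₀
        simpa using h2
      · have : r / ((n : ℝ) + 2) ≠ 0 := by positivity
        simpa only [mem_compl_iff, mem_singleton_iff, add_eq_left, Complex.ofReal_eq_zero] using this
    have hmem : ∀ n : ℕ, z₀ + ((r / (n + 2) : ℝ) : ℂ) ∈ ball z₀ r := fun n => by
      have h2 : r / ((n : ℝ) + 2) < r := div_lt_self hr (by linarith [n.cast_nonneg (α := ℝ)])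
      have h3 : 0 < r / ((n : ℝ) + 2) := by positivity
      rw [mem_ball, dist_eq_norm, add_sub_cancel_left, Complex.norm_real, Real.norm_eq_abs,
        abs_of_pos h3]
      exact h2
    refine aestronglyMeasurable_of_tendsto_ae atTop
      (f := fun (n : ℕ) t => slope (fun z => g z t) z₀ (z₀ + ((r / (n + 2) : ℝ) : ℂ)))
      (fun n => ?_) ?_
    · simp only [slope, vsub_eq_sub]
      exact ((hmeas _ (hmem n)).sub (hmeas _ hz₀)).const_smul (z₀ + ((r / (n + 2) : ℝ) : ℂ) - z₀)⁻¹
    · refine (MeasureTheory.ae_restrict_iff' measurableSet_uIoc).2 (.of_forall fun t ht => ?_)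
      exact (hasDerivAt_iff_tendsto_slope.1 (hderiv t (hIcc t ht) z₀ hz₀)).comp hu
  · refine .of_forall fun t ht z hz => ?_
    have hsub : closedBall z (r / 4) ⊆ ball z₀ r := fun w hw => by
      rw [mem_ball] at hz ⊢
      rw [mem_closedBall] at hw
      linarith [dist_triangle w z z₀]
    refine Complex.norm_deriv_le_of_forall_mem_sphere_norm_le (by positivity) ?_ fun w hw =>
      hb t (hIcc t ht) w (hsub (sphere_subset_closedBall hw))
    exact ((hd t (hIcc t ht)).mono hsub).diffContOnCl_ball subset_rfl
  · exact intervalIntegrable_const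
  · exact .of_forall fun t ht z hz => hderiv t (hIcc t ht) z (ball_subset_ball (by linarith) hz)

lemma dslope_symm (f : ℂ → ℂ) (a b : ℂ) : dslope f a b = dslope f b a := by
  rcases eq_or_ne a b with rfl | h
  · rfl
  · rw [dslope_of_ne _ h.symm, dslope_of_ne _ h, slope_comm]

/-- A Cauchy integral over a curve depends holomorphically on the pole off the curve. -/
lemma hasDerivAt_integral_div_sub {u v : ℝ → ℂ} (hu : ContinuousOn u (Icc 0 1))
    (hv : ContinuousOn v (Icc 0 1)) {D : Set ℂ} (hD : IsOpen D)
    (huD : ∀ t ∈ Icc (0 : ℝ) 1, u t ∉ D) {z₀ : ℂ} (hz₀ : z₀ ∈ D) :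
    HasDerivAt (fun z => ∫ t in (0 : ℝ)..1, v t / (u t - z))
      (∫ t in (0 : ℝ)..1, v t / (u t - z₀) ^ 2) z₀ := by
  obtain ⟨r, hr, hrD⟩ := Metric.isOpen_iff.1 hD z₀ hz₀
  obtain ⟨M, hM⟩ := isCompact_Icc.exists_bound_of_continuousOn hv
  have hne : ∀ t ∈ Icc (0 : ℝ) 1, ∀ z ∈ ball z₀ r, u t - z ≠ 0 := fun t ht z hz h =>
    huD t ht (by rw [sub_eq_zero.1 h]; exact hrD hz)
  have hsub : ball z₀ (r / 2) ⊆ ball z₀ r := ball_subset_ball (by linarith)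
  have hderiv : ∀ t ∈ Icc (0 : ℝ) 1, ∀ z ∈ ball z₀ r,
      HasDerivAt (fun z => v t / (u t - z)) (v t / (u t - z) ^ 2) z := fun t ht z hz => by
    have h := ((hasDerivAt_id z).const_sub (u t)).inv (hne t ht z hz)
    simpa [div_eq_mul_inv] using h.const_mul (v t)
  have key := hasDerivAt_integral_of_bounded_holomorphic (g := fun z t => v t / (u t - z))
    (z₀ := z₀) (r := r / 2) (M := M / (r / 2)) (by positivity)
    (fun t ht z hz => (hderiv t ht z (hsub hz)).differentiableAt.differentiableWithinAt)
    (fun t ht z hz => ?_) (fun z hz => hv.div (hu.sub continuousOn_const)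
      fun t ht => hne t ht z (hsub hz))
  · refine key.congr_deriv (intervalIntegral.integral_congr fun t ht => ?_)
    rw [uIcc_of_le zero_le_one] at ht
    exact (hderiv t ht z₀ (mem_ball_self hr)).deriv
  · rw [norm_div]
    have h1 : r / 2 ≤ ‖u t - z‖ := by
      have h2 : r ≤ dist (u t) z₀ := not_lt.1 fun h => huD t ht (hrD h)
      rw [mem_ball] at hz
      rw [← dist_eq_norm]
      linarith [dist_triangle (u t) z z₀]
    exact div_le_div₀ ((norm_nonneg _).trans (hM t ht)) (hM t ht) (by positivity) h1

/-- The integral of a difference quotient of `f` along a curve is holomorphic where `f` is. -/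
lemma differentiableAt_integral_dslope {u v : ℝ → ℂ} {f : ℂ → ℂ} (hu : ContinuousOn u (Icc 0 1))
    (hv : ContinuousOn v (Icc 0 1)) (hf : ∀ t ∈ Icc (0 : ℝ) 1, AnalyticAt ℂ f (u t)) {z₀ : ℂ}
    (hz₀ : AnalyticAt ℂ f z₀) :
    DifferentiableAt ℂ (fun z => ∫ t in (0 : ℝ)..1, dslope f z (u t) * v t) z₀ := by
  obtain ⟨r₀, hr₀, hball₀⟩ := Metric.eventually_nhds_iff_ball.1 hz₀.eventually_analyticAt
  obtain ⟨r, hr, hball⟩ : ∃ r > 0, ∀ z ∈ closedBall z₀ (2 * r), AnalyticAt ℂ f z :=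
    ⟨r₀ / 4, by positivity, fun z hz => hball₀ z (by
      rw [mem_closedBall] at hz
      rw [mem_ball]
      linarith)⟩
  have hfu : ContinuousOn (fun t => f (u t)) (Icc 0 1) := fun t ht =>
    ((hf t ht).continuousAt).comp_continuousWithinAt (hu t ht)
  obtain ⟨Mv, hMv⟩ := isCompact_Icc.exists_bound_of_continuousOn hv
  obtain ⟨Mu, hMu⟩ := isCompact_Icc.exists_bound_of_continuousOn hfu
  obtain ⟨Mf, hMf⟩ := (isCompact_closedBall z₀ (2 * r)).exists_bound_of_continuousOn
    (f := f) fun z hz => (hball z hz).continuousAt.continuousWithinAt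
  obtain ⟨Md, hMd⟩ := (isCompact_closedBall z₀ (2 * r)).exists_bound_of_continuousOn
    (f := deriv f) fun z hz => (hball z hz).deriv.continuousAt.continuousWithinAt
  have hMd0 : 0 ≤ Md := (norm_nonneg _).trans (hMd z₀ (mem_closedBall_self (by positivity)))
  have hsub : ball z₀ r ⊆ closedBall z₀ (2 * r) :=
    ball_subset_closedBall.trans (closedBall_subset_closedBall (by linarith))
  have hbound : ∀ t ∈ Icc (0 : ℝ) 1, ∀ z ∈ ball z₀ r,
      ‖dslope f z (u t)‖ ≤ max Md ((Mu + Mf) / r) := fun t ht z hz => by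
    rcases eq_or_ne (u t) z with h | h
    · rw [h, dslope_same]
      exact (hMd z (hsub hz)).trans (le_max_left _ _)
    · rw [dslope_of_ne _ h, slope_def_field, norm_div]
      have hpos : 0 < ‖u t - z‖ := norm_pos_iff.2 (sub_ne_zero.2 h)
      by_cases hut : u t ∈ closedBall z₀ (2 * r)
      · refine le_trans ?_ (le_max_left _ _)
        rw [div_le_iff₀ hpos]
        exact (convex_closedBall z₀ (2 * r)).norm_image_sub_le_of_norm_deriv_le
          (fun x hx => (hball x hx).differentiableAt) hMd (hsub hz) hut
      · refine le_trans ?_ (le_max_right _ _)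
        have h1 : r ≤ ‖u t - z‖ := by
          rw [mem_closedBall, not_le] at hut
          rw [mem_ball] at hz
          rw [← dist_eq_norm]
          linarith [dist_triangle (u t) z z₀]
        have h2 : ‖f (u t) - f z‖ ≤ Mu + Mf :=
          (norm_sub_le _ _).trans (add_le_add (hMu t ht) (hMf z (hsub hz)))
        exact div_le_div₀ ((norm_nonneg _).trans h2) h2 hr h1
  refine (hasDerivAt_integral_of_bounded_holomorphic
    (g := fun z t => dslope f z (u t) * v t) hr (M := max Md ((Mu + Mf) / r) * Mv)
    (fun t ht => ?_) (fun t ht z hz => ?_) (fun z hz => ?_)).differentiableAt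
  · simp only [dslope_symm f _ (u t)]
    refine DifferentiableOn.mul_const ?_ _
    have hfd : DifferentiableOn ℂ f (ball z₀ r) := fun z hz =>
      (hball z (hsub hz)).differentiableAt.differentiableWithinAt
    by_cases hut : u t ∈ ball z₀ r
    · exact (Complex.differentiableOn_dslope (isOpen_ball.mem_nhds hut)).2 hfd
    · exact (differentiableOn_dslope_of_notMem hut).2 hfd
  · rw [norm_mul]
    exact mul_le_mul (hbound t ht z hz) (hMv t ht) (norm_nonneg _)
      (hMd0.trans (le_max_left _ _))
  · refine ContinuousOn.mul (fun t ht => ?_) hv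
    have h1 : ContinuousAt (dslope f z) (u t) := by
      rcases eq_or_ne (u t) z with h | h
      · rw [h, continuousAt_dslope_same]
        exact (hball z (hsub hz)).differentiableAt
      · rw [continuousAt_dslope_of_ne h]
        exact (hf t ht).continuousAt
    exact h1.comp_continuousWithinAt (hu t ht)

lemma tendsto_integral_div_sub_cocompact {u v : ℝ → ℂ} (hu : ContinuousOn u (Icc 0 1))
    (hv : ContinuousOn v (Icc 0 1)) :
    Tendsto (fun z => ∫ t in (0 : ℝ)..1, v t / (u t - z)) (cocompact ℂ) (𝓝 0) := by
  obtain ⟨R, hR⟩ := isCompact_Icc.exists_bound_of_continuousOn hu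
  obtain ⟨M, hM⟩ := isCompact_Icc.exists_bound_of_continuousOn hv
  have hlim : Tendsto (fun z : ℂ => M / (‖z‖ - R)) (cocompact ℂ) (𝓝 0) :=
    tendsto_const_nhds.div_atTop (tendsto_atTop_add_const_right _ _ tendsto_norm_cocompact_atTop)
  refine squeeze_zero_norm' ?_ hlim
  filter_upwards [tendsto_norm_cocompact_atTop.eventually_gt_atTop R] with z hz
  have h := intervalIntegral.norm_integral_le_of_norm_le_const (a := (0 : ℝ)) (b := 1)
    (f := fun t => v t / (u t - z)) (C := M / (‖z‖ - R)) fun t ht => by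
      rw [uIoc_of_le zero_le_one] at ht
      have ht' := Ioc_subset_Icc_self ht
      rw [norm_div]
      refine div_le_div₀ ((norm_nonneg _).trans (hM t ht')) (hM t ht') (by linarith) ?_
      rw [norm_sub_rev]
      linarith [norm_sub_norm_le z (u t), hR t ht']
  simpa using h

lemma tendsto_mul_integral_div_sub_cocompact {u v : ℝ → ℂ} (hu : ContinuousOn u (Icc 0 1))
    (hv : ContinuousOn v (Icc 0 1)) :
    Tendsto (fun z => z * ∫ t in (0 : ℝ)..1, v t / (u t - z)) (cocompact ℂ)
      (𝓝 (-∫ t in (0 : ℝ)..1, v t)) := by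
  obtain ⟨R, hR⟩ := isCompact_Icc.exists_bound_of_continuousOn hu
  have h := (tendsto_integral_div_sub_cocompact hu (hv.mul hu)).sub_const
    (∫ t in (0 : ℝ)..1, v t)
  rw [zero_sub] at h
  refine h.congr' ?_
  filter_upwards [tendsto_norm_cocompact_atTop.eventually_gt_atTop R] with z hz
  have hne : ∀ t ∈ Icc (0 : ℝ) 1, u t - z ≠ 0 := fun t ht h => by
    have := hR t ht
    rw [sub_eq_zero.1 h] at this
    linarith
  have hI : uIcc (0 : ℝ) 1 = Icc 0 1 := uIcc_of_le zero_le_one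
  rw [← intervalIntegral.integral_const_mul, ← intervalIntegral.integral_sub]
  · refine intervalIntegral.integral_congr fun t ht => ?_
    have := hne t (hI ▸ ht)
    simp only [Pi.mul_apply]
    field_simp
    ring
  · exact ContinuousOn.intervalIntegrable (hI ▸ (hv.mul hu).div (hu.sub continuousOn_const) hne)
  · exact ContinuousOn.intervalIntegrable (hI ▸ hv)

/-- Cauchy's theorem for the exterior of an open set `D`: if a cycle avoiding `D` winds once around
each point of `D` and `f` is analytic outside `D` with `z f(z) → c` at infinity, then the
integral of `f` over the cycle is `2πi c`. -/
theorem sum_integral_eq_of_analyticAt_compl {n : ℕ} {γ : Fin n → ℝ → ℂ}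
    (hγ : ∀ i, ContDiff ℝ 1 (γ i)) {D : Set ℂ} (hD : IsOpen D)
    (hγD : ∀ i, ∀ t ∈ Icc (0 : ℝ) 1, γ i t ∉ D)
    (hwind : ∀ z ∈ D, (∑ i, ∫ t in (0 : ℝ)..1, deriv (γ i) t / (γ i t - z)) =
      2 * (Real.pi : ℂ) * Complex.I)
    {f : ℂ → ℂ} (hf : ∀ z ∉ D, AnalyticAt ℂ f z) {c : ℂ}
    (hc : Tendsto (fun z => z * f z) (cocompact ℂ) (𝓝 c)) :
    (∑ i, ∫ t in (0 : ℝ)..1, f (γ i t) * deriv (γ i) t) = 2 * (Real.pi : ℂ) * Complex.I * c := by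
  have hu : ∀ i, ContinuousOn (γ i) (Icc 0 1) := fun i => (hγ i).continuous.continuousOn
  have hv : ∀ i, ContinuousOn (deriv (γ i)) (Icc 0 1) := fun i =>
    ((hγ i).continuous_deriv le_rfl).continuousOn
  have hfv : ∀ i, ContinuousOn (fun t => f (γ i t) * deriv (γ i) t) (Icc 0 1) := fun i =>
    ContinuousOn.mul (fun t ht => ((hf _ (hγD i t ht)).continuousAt).comp_continuousWithinAt
      (hu i t ht)) (hv i)
  have hI : uIcc (0 : ℝ) 1 = Icc 0 1 := uIcc_of_le zero_le_one
  set w : ℂ → ℂ := fun z => ∑ i, ∫ t in (0 : ℝ)..1, deriv (γ i) t / (γ i t - z) with hw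
  set C : ℂ → ℂ := fun z => ∑ i, ∫ t in (0 : ℝ)..1, f (γ i t) * deriv (γ i) t / (γ i t - z) with hC
  set Q : ℂ → ℂ := fun z => (∑ i, ∫ t in (0 : ℝ)..1, dslope f z (γ i t) * deriv (γ i) t) +
    2 * (Real.pi : ℂ) * Complex.I * f z with hQ
  have hQC : ∀ z, (∀ i, ∀ t ∈ Icc (0 : ℝ) 1, γ i t ≠ z) →
      Q z = C z - f z * w z + 2 * (Real.pi : ℂ) * Complex.I * f z := fun z hz => by
    simp only [hQ, hC, hw, Finset.mul_sum, ← Finset.sum_sub_distrib, add_left_inj]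
    refine Finset.sum_congr rfl fun i _ => ?_
    have hden : ContinuousOn (fun t => γ i t - z) (Icc 0 1) := (hu i).sub continuousOn_const
    have hne : ∀ t ∈ Icc (0 : ℝ) 1, γ i t - z ≠ 0 := fun t ht => sub_ne_zero.2 (hz i t ht)
    rw [← intervalIntegral.integral_const_mul, ← intervalIntegral.integral_sub]
    · refine intervalIntegral.integral_congr fun t ht => ?_
      rw [hI] at ht
      simp only [dslope_of_ne _ (hz i t ht), slope_def_field]
      have := hne t ht
      field_simp
    · exact ContinuousOn.intervalIntegrable (hI ▸ (hfv i).div hden hne)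
    · exact ContinuousOn.intervalIntegrable
        (hI ▸ continuousOn_const.mul ((hv i).div hden hne))
  classical
  set Ψ : ℂ → ℂ := fun z => if z ∈ D then C z else Q z with hΨ
  have hΨD : ∀ z ∈ D, Ψ z = Q z := fun z hz => by
    have h := hQC z fun i t ht h => hγD i t ht (h ▸ hz)
    rw [show w z = _ from hwind z hz] at h
    simp only [hΨ, if_pos hz]
    rw [h]
    ring
  have hΨQ : Ψ = Q := funext fun z => by
    by_cases hz : z ∈ D
    · exact hΨD z hz
    · simp only [hΨ, if_neg hz]
  have hdiff : Differentiable ℂ Ψ := fun z => by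
    by_cases hz : z ∈ D
    · have h : DifferentiableAt ℂ C z := by
        simp only [hC]
        exact DifferentiableAt.fun_sum fun i _ =>
          (hasDerivAt_integral_div_sub (hu i) (hfv i) hD (hγD i) hz).differentiableAt
      refine h.congr_of_eventuallyEq ?_
      filter_upwards [hD.mem_nhds hz] with y hy
      simp only [hΨ, if_pos hy]
    · rw [hΨQ]
      refine DifferentiableAt.add (DifferentiableAt.fun_sum fun i _ => ?_)
        ((hf z hz).differentiableAt.const_mul _)
      exact differentiableAt_integral_dslope (hu i) (hv i) (fun t ht => hf _ (hγD i t ht)) (hf z hz)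
  have hlarge : ∀ᶠ z in cocompact ℂ, ∀ i, ∀ t ∈ Icc (0 : ℝ) 1, γ i t ≠ z := by
    refine eventually_all.2 fun i => ?_
    filter_upwards [(isCompact_Icc.image_of_continuousOn (hu i)).compl_mem_cocompact]
      with z hz t ht h
    exact hz ⟨t, ht, h⟩
  have hw0 : Tendsto w (cocompact ℂ) (𝓝 0) := by
    simpa using tendsto_finsetSum Finset.univ fun i _ =>
      tendsto_integral_div_sub_cocompact (hu i) (hv i)
  have hzC : Tendsto (fun z => z * C z) (cocompact ℂ)
      (𝓝 (-∑ i, ∫ t in (0 : ℝ)..1, f (γ i t) * deriv (γ i) t)) := by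
    simp only [hC, Finset.mul_sum, ← Finset.sum_neg_distrib]
    exact tendsto_finsetSum Finset.univ fun i _ =>
      tendsto_mul_integral_div_sub_cocompact (hu i) (hfv i)
  have hzΨ : Tendsto (fun z => z * Ψ z) (cocompact ℂ)
      (𝓝 (-(∑ i, ∫ t in (0 : ℝ)..1, f (γ i t) * deriv (γ i) t) - c * 0 +
        2 * (Real.pi : ℂ) * Complex.I * c)) := by
    refine ((hzC.sub (hc.mul hw0)).add (hc.const_mul _)).congr' ?_
    filter_upwards [hlarge] with z hz
    rw [hΨQ, hQC z hz]
    ring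
  have hΨ0 : Tendsto Ψ (cocompact ℂ) (𝓝 0) := by
    have h := (cobounded_eq_cocompact (α := ℂ) ▸ tendsto_inv₀_cobounded (α := ℂ)).mul hzΨ
    rw [zero_mul] at h
    refine h.congr' ?_
    filter_upwards [(isCompact_singleton (x := (0 : ℂ))).compl_mem_cocompact] with z hz
    rw [← mul_assoc, inv_mul_cancel₀ hz, one_mul]
  have hzero : ∀ z, Ψ z = 0 := fun z => hdiff.apply_eq_of_tendsto_cocompact z hΨ0
  simp only [hzero, mul_zero, sub_zero] at hzΨ
  have h := tendsto_nhds_unique tendsto_const_nhds hzΨ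
  linear_combination h

lemma pi_div_four_le_abs_arctan_sub {A B : ℝ} (hA : 1 ≤ A) (hB : B ≤ 0) :
    Real.pi / 4 ≤ |Real.arctan A - Real.arctan B| := by
  have h1 : Real.pi / 4 ≤ Real.arctan A := by
    rw [← Real.arctan_one]; exact Real.arctan_strictMono.monotone hA
  have h2 : Real.arctan B ≤ 0 := by
    rw [← Real.arctan_zero]; exact Real.arctan_strictMono.monotone hB
  exact le_trans (by linarith) (le_abs_self _)

lemma integral_div_sub_eq_of_isPreconnected {γ : ℝ → ℂ} {D : Set ℂ} (hγ : ContDiff ℝ 1 γ)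
    (hcl : γ 0 = γ 1) (hD : IsOpen D) (hDc : IsPreconnected D) (hγD : ∀ t ∈ Icc (0 : ℝ) 1, γ t ∉ D)
    {z w : ℂ} (hz : z ∈ D) (hw : w ∈ D) :
    (∫ t in (0 : ℝ)..1, deriv γ t / (γ t - z)) = ∫ t in (0 : ℝ)..1, deriv γ t / (γ t - w) := by
  have hc : Continuous (deriv γ) := hγ.continuous_deriv le_rfl
  have hd (z : ℂ) (hz : z ∈ D) :
      HasDerivAt (fun z => ∫ t in (0 : ℝ)..1, deriv γ t / (γ t - z)) 0 z := by
    have h := hasDerivAt_integral_div_sub hγ.continuous.continuousOn hc.continuousOn hD hγD hz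
    have hne : ∀ t ∈ uIcc (0 : ℝ) 1, γ t - z ≠ 0 := by
      intro t ht h0
      rw [uIcc_of_le zero_le_one] at ht
      exact hγD t ht (by rwa [sub_eq_zero.1 h0])
    have h2 : (∫ t in (0 : ℝ)..1, deriv γ t / (γ t - z) ^ 2) =
        -(γ 1 - z)⁻¹ - -(γ 0 - z)⁻¹ := by
      apply intervalIntegral.integral_eq_sub_of_hasDerivAt (f := fun t => -(γ t - z)⁻¹)
      · intro t ht
        have := ((((hγ.differentiable one_ne_zero) t).hasDerivAt.sub_const z).fun_inv (hne t ht)).fun_neg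
        convert this using 1
        field_simp
      · apply ContinuousOn.intervalIntegrable
        apply hc.continuousOn.div ((hγ.continuous.sub continuous_const).pow 2).continuousOn
        intro t ht
        exact pow_ne_zero _ (hne t ht)
    rw [h2, hcl, sub_self] at h
    exact h
  exact hD.is_const_of_deriv_eq_zero hDc
    (fun z hz => (hd z hz).differentiableAt.differentiableWithinAt)
    (fun z hz => (hd z hz).deriv) hz hw

lemma exists_ball_im_ne_zero_notMem {γ : ℝ → ℂ} {D : Set ℂ} (hγ : ContDiff ℝ 1 γ)
    (hcl : γ 0 = γ 1) (hinj : InjOn γ (Ico 0 1)) (hD : IsOpen D) (hDc : IsPreconnected D)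
    (hγD : ∀ t ∈ Icc (0 : ℝ) 1, γ t ∉ D) {t₀ : ℝ} (ht₀ : t₀ ∈ Ioo (0 : ℝ) 1) {r : ℝ} (hr : 0 < r) :
    ∃ z ∈ ball (γ t₀) r, z.im ≠ 0 ∧ z ∉ D := by
  by_contra! hcon
  have hc : Continuous (deriv γ) := hγ.continuous_deriv le_rfl
  have hdγ : ∀ t, HasDerivAt γ (deriv γ t) t :=
    fun t => ((hγ.differentiable one_ne_zero) t).hasDerivAt
  have hreal : ∀ t ∈ Icc (0 : ℝ) 1, γ t ∈ ball (γ t₀) r → (γ t).im = 0 := by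
    intro t ht hb
    by_contra h
    exact hγD t ht (hcon _ hb h)
  have ht₀' : t₀ ∈ Icc (0 : ℝ) 1 := Ioo_subset_Icc_self ht₀
  have hs0 : (γ t₀).im = 0 := hreal t₀ ht₀' (mem_ball_self hr)
  obtain ⟨ε, hε, hεb⟩ : ∃ ε > 0, closedBall t₀ ε ⊆ Ioo 0 1 ∩ γ ⁻¹' ball (γ t₀) r := by
    apply nhds_basis_closedBall.mem_iff.1
    exact inter_mem (isOpen_Ioo.mem_nhds ht₀)
      ((isOpen_ball.preimage hγ.continuous).mem_nhds (mem_ball_self hr))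
  rw [Real.closedBall_eq_Icc] at hεb
  obtain ⟨p, hp⟩ : ∃ p, p = t₀ - ε := ⟨_, rfl⟩
  obtain ⟨q, hq⟩ : ∃ q, q = t₀ + ε := ⟨_, rfl⟩
  rw [← hp, ← hq] at hεb
  have hpt : p < t₀ := by linarith
  have htq : t₀ < q := by linarith
  have hpq : p ≤ q := by linarith
  have hp0 : 0 < p := (hεb ⟨le_rfl, hpq⟩).1.1
  have hq1 : q < 1 := (hεb ⟨hpq, le_rfl⟩).1.2
  have him : ∀ t ∈ Icc p q, (γ t).im = 0 := fun t ht =>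
    hreal t (Ioo_subset_Icc_self (hεb ht).1) (hεb ht).2
  have hxinj : InjOn (fun t => (γ t).re) (Icc p q) := by
    intro a ha b hb hab
    exact hinj ⟨(hεb ha).1.1.le, (hεb ha).1.2⟩ ⟨(hεb hb).1.1.le, (hεb hb).1.2⟩
      (Complex.ext hab ((him a ha).trans (him b hb).symm))
  have hxc : Continuous (fun t => (γ t).re) := Complex.continuous_re.comp hγ.continuous
  have hmono := hxc.continuousOn.strictMonoOn_of_injOn_Icc' hpq hxinj
  -- distance from the rest of the curve
  obtain ⟨d, hd, hdist⟩ : ∃ d > 0, ∀ t ∈ Icc 0 p ∪ Icc q 1, d ≤ ‖γ t - γ t₀‖ := by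
    have hK : IsCompact (Icc 0 p ∪ Icc q 1) := isCompact_Icc.union isCompact_Icc
    have hne : (Icc 0 p ∪ Icc q 1).Nonempty := ⟨0, Or.inl ⟨le_rfl, hp0.le⟩⟩
    obtain ⟨t, ht, hmin⟩ := hK.exists_isMinOn hne
      ((hγ.continuous.sub continuous_const).norm.continuousOn (s := Icc 0 p ∪ Icc q 1)
        (f := fun t => ‖γ t - γ t₀‖))
    refine ⟨‖γ t - γ t₀‖, norm_pos_iff.2 (sub_ne_zero.2 fun h => ?_), fun t' ht' => hmin ht'⟩
    have htt : t₀ ∈ Ico (0 : ℝ) 1 := ⟨ht₀.1.le, ht₀.2⟩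
    rcases eq_or_ne t 1 with rfl | h1
    · rw [← hcl] at h
      exact ht₀.1.ne (hinj ⟨le_rfl, zero_lt_one⟩ htt h)
    · rcases ht with ht | ht
      · have := hinj ⟨ht.1, by linarith [ht.2]⟩ htt h
        linarith [ht.2]
      · have := hinj ⟨by linarith [ht.1], lt_of_le_of_ne ht.2 h1⟩ htt h
        linarith [ht.1]
  obtain ⟨M, hM⟩ : ∃ M, ∀ t ∈ Icc (0 : ℝ) 1, ‖deriv γ t‖ ≤ M := by
    obtain ⟨M, hM⟩ := isCompact_Icc.exists_bound_of_continuousOn hc.continuousOn (s := Icc (0 : ℝ) 1)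
    exact ⟨M, hM⟩
  have hM0 : 0 ≤ M := (norm_nonneg _).trans (hM 0 ⟨le_rfl, zero_le_one⟩)
  set A : ℝ := (γ q).re - (γ t₀).re with hA
  set B : ℝ := (γ p).re - (γ t₀).re with hB
  have key : ∀ η : ℝ, 0 < η → η < r → η ^ 2 ≤ d ^ 2 / 2 →
      |Real.arctan (A / η) - Real.arctan (B / η)| ≤ 4 * M * η / d ^ 2 := by
    intro η hη hηr hηd
    set f : ℝ → ℂ := fun t => deriv γ t * η / ((γ t - γ t₀) ^ 2 + η ^ 2) with hf
    have hne1 : ∀ t ∈ Icc (0 : ℝ) 1, γ t - (γ t₀ + η * Complex.I) ≠ 0 := by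
      intro t ht h0
      refine hγD t ht ?_
      rw [sub_eq_zero.1 h0]
      apply hcon
      · simp [abs_of_pos hη, hηr]
      · simp [hs0, hη.ne']
    have hne2 : ∀ t ∈ Icc (0 : ℝ) 1, γ t - (γ t₀ - η * Complex.I) ≠ 0 := by
      intro t ht h0
      refine hγD t ht ?_
      rw [sub_eq_zero.1 h0]
      apply hcon
      · rw [mem_ball, dist_eq_norm]; simp [abs_of_pos hη, hηr]
      · simp [hs0, hη.ne']
    have hfac : ∀ t, (γ t - γ t₀) ^ 2 + η ^ 2 =
        (γ t - (γ t₀ + η * Complex.I)) * (γ t - (γ t₀ - η * Complex.I)) := by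
      intro t; linear_combination (η:ℂ) ^ 2 * Complex.I_sq
    have hfne : ∀ t ∈ Icc (0 : ℝ) 1, (γ t - γ t₀) ^ 2 + (η : ℂ) ^ 2 ≠ 0 := by
      intro t ht; rw [hfac]; exact mul_ne_zero (hne1 t ht) (hne2 t ht)
    have hfc : ContinuousOn f (Icc 0 1) := by
      apply ContinuousOn.div
      · exact (hc.mul continuous_const).continuousOn
      · exact (((hγ.continuous.sub continuous_const).pow 2).add continuous_const).continuousOn
      · exact hfne
    have hint : ∀ a b, a ∈ Icc (0 : ℝ) 1 → b ∈ Icc (0 : ℝ) 1 →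
        IntervalIntegrable f MeasureTheory.volume a b := by
      intro a b ha hb
      exact (hfc.mono (uIcc_subset_Icc ha hb)).intervalIntegrable
    have hI1 : ∀ w : ℂ, (∀ t ∈ Icc (0 : ℝ) 1, γ t - w ≠ 0) →
        IntervalIntegrable (fun t => deriv γ t / (γ t - w)) MeasureTheory.volume 0 1 := by
      intro w hw
      apply ContinuousOn.intervalIntegrable
      rw [uIcc_of_le zero_le_one]
      exact hc.continuousOn.div (hγ.continuous.sub continuous_const).continuousOn hw
    have h0 : ∫ t in (0 : ℝ)..1, f t = 0 := by
      have h1 := integral_div_sub_eq_of_isPreconnected hγ hcl hD hDc hγD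
        (z := γ t₀ + η * Complex.I) (w := γ t₀ - η * Complex.I)
        (hcon _ (by simp [abs_of_pos hη, hηr]) (by simp [hs0, hη.ne']))
        (hcon _ (by rw [mem_ball, dist_eq_norm]; simp [abs_of_pos hη, hηr]) (by simp [hs0, hη.ne']))
      rw [← sub_eq_zero, ← intervalIntegral.integral_sub (hI1 _ hne1) (hI1 _ hne2)] at h1
      have h2 : (∫ t in (0 : ℝ)..1, (deriv γ t / (γ t - (γ t₀ + η * Complex.I)) -
          deriv γ t / (γ t - (γ t₀ - η * Complex.I)))) = ∫ t in (0 : ℝ)..1, (2 * Complex.I) * f t := by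
        apply intervalIntegral.integral_congr
        intro t ht
        rw [uIcc_of_le zero_le_one] at ht
        have e1 := hne1 t ht
        have e2 := hne2 t ht
        simp only [hf]
        rw [hfac, div_sub_div _ _ e1 e2, mul_div_assoc']
        congr 1
        ring
      rw [h2, intervalIntegral.integral_const_mul] at h1
      simpa using h1
    have m0 : (0 : ℝ) ∈ Icc (0 : ℝ) 1 := ⟨le_rfl, zero_le_one⟩
    have m1 : (1 : ℝ) ∈ Icc (0 : ℝ) 1 := ⟨zero_le_one, le_rfl⟩
    have mp : p ∈ Icc (0 : ℝ) 1 := ⟨hp0.le, by linarith⟩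
    have mq : q ∈ Icc (0 : ℝ) 1 := ⟨by linarith, hq1.le⟩
    have hsplit : (∫ t in p..q, f t) = -((∫ t in (0:ℝ)..p, f t) + ∫ t in q..1, f t) := by
      have := intervalIntegral.integral_add_adjacent_intervals (hint 0 p m0 mp) (hint p q mp mq)
      have h' := intervalIntegral.integral_add_adjacent_intervals (hint 0 q m0 mq) (hint q 1 mq m1)
      rw [h0, ← this] at h'
      linear_combination h'
    have hbd : ∀ t ∈ Icc 0 p ∪ Icc q 1, ‖f t‖ ≤ 2 * M * η / d ^ 2 := by
      intro t ht
      have ht' : t ∈ Icc (0 : ℝ) 1 := by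
        rcases ht with h | h
        · exact ⟨h.1, by linarith [h.2]⟩
        · exact ⟨by linarith [h.1], h.2⟩
      have hl : d ^ 2 / 2 ≤ ‖(γ t - γ t₀) ^ 2 + (η : ℂ) ^ 2‖ := by
        have h1 := norm_sub_norm_le ((γ t - γ t₀) ^ 2) (-(η : ℂ) ^ 2)
        rw [sub_neg_eq_add, norm_neg, norm_pow, norm_pow, Complex.norm_real, Real.norm_eq_abs,
          sq_abs] at h1
        have h2 : d ^ 2 ≤ ‖γ t - γ t₀‖ ^ 2 := by gcongr; exact hdist t ht
        linarith
      simp only [hf]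
      rw [norm_div, norm_mul, Complex.norm_real, Real.norm_eq_abs, abs_of_pos hη,
        div_le_iff₀ (lt_of_lt_of_le (by positivity) hl)]
      calc ‖deriv γ t‖ * η ≤ M * η := by gcongr; exact hM t ht'
        _ = 2 * M * η / d ^ 2 * (d ^ 2 / 2) := by field_simp
        _ ≤ _ := by gcongr
    have hmid : (∫ t in p..q, (f t).re) = Real.arctan (A / η) - Real.arctan (B / η) := by
      apply intervalIntegral.integral_eq_sub_of_hasDerivAt
        (f := fun t => Real.arctan (((γ t).re - (γ t₀).re) / η))
      · intro t ht
        rw [uIcc_of_le hpq] at ht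
        have hre : HasDerivAt (fun t => (γ t).re) (deriv γ t).re t :=
          Complex.reCLM.hasFDerivAt.comp_hasDerivAt t (hdγ t)
        have h1 := ((hre.sub_const (γ t₀).re).div_const η).arctan
        refine HasDerivAt.congr_deriv (f := fun t => Real.arctan (((γ t).re - (γ t₀).re) / η)) h1 (Eq.symm ?_)
        have e1 : (γ t - γ t₀) ^ 2 + (η : ℂ) ^ 2 = (((γ t).re - (γ t₀).re) ^ 2 + η ^ 2 : ℝ) := by
          have : γ t - γ t₀ = (((γ t).re - (γ t₀).re : ℝ) : ℂ) := by
            apply Complex.ext <;> simp [him t ht, hs0]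
          rw [this]; push_cast; ring
        show (deriv γ t * (η : ℂ) / ((γ t - γ t₀) ^ 2 + (η : ℂ) ^ 2)).re = _
        rw [e1, Complex.div_ofReal_re, Complex.re_mul_ofReal]
        have : 0 < ((γ t).re - (γ t₀).re) ^ 2 + η ^ 2 := by positivity
        have h3 : 0 < 1 + (((γ t).re - (γ t₀).re) / η) ^ 2 := by positivity
        field_simp
        ring
      · apply ContinuousOn.intervalIntegrable
        exact Complex.continuous_re.comp_continuousOn (hfc.mono (uIcc_subset_Icc mp mq))
    have hre : (∫ t in p..q, (f t).re) = (∫ t in p..q, f t).re :=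
      Complex.reCLM.intervalIntegral_comp_comm (hint p q mp mq)
    rw [← hmid, hre, hsplit]
    refine (Complex.abs_re_le_norm _).trans ?_
    rw [norm_neg]
    refine (norm_add_le _ _).trans ?_
    have b1 : ‖∫ t in (0:ℝ)..p, f t‖ ≤ 2 * M * η / d ^ 2 * |p - 0| :=
      intervalIntegral.norm_integral_le_of_norm_le_const fun t ht => by
        rw [uIoc_of_le hp0.le] at ht; exact hbd t (Or.inl ⟨ht.1.le, ht.2⟩)
    have b2 : ‖∫ t in q..1, f t‖ ≤ 2 * M * η / d ^ 2 * |1 - q| :=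
      intervalIntegral.norm_integral_le_of_norm_le_const fun t ht => by
        rw [uIoc_of_le hq1.le] at ht; exact hbd t (Or.inr ⟨ht.1.le, ht.2⟩)
    rw [sub_zero, abs_of_pos hp0] at b1
    rw [abs_of_pos (by linarith)] at b2
    have h3 : 0 ≤ 2 * M * η / d ^ 2 := by positivity
    have e : 4 * M * η / d ^ 2 = 2 * M * η / d ^ 2 * 2 := by ring
    rw [e]
    nlinarith
  -- the middle jump is at least `π / 4`
  have hjump : ∃ a > 0, ∀ η : ℝ, 0 < η → η ≤ a →
      Real.pi / 4 ≤ |Real.arctan (A / η) - Real.arctan (B / η)| := by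
    have mp : p ∈ Icc p q := ⟨le_rfl, hpq⟩
    have mq : q ∈ Icc p q := ⟨hpq, le_rfl⟩
    have mt : t₀ ∈ Icc p q := ⟨hpt.le, htq.le⟩
    rcases hmono with h | h
    · have hA0 : 0 < A := sub_pos.2 (h mt mq htq)
      have hB0 : B < 0 := sub_neg.2 (h mp mt hpt)
      refine ⟨A, hA0, fun η hη hηa => pi_div_four_le_abs_arctan_sub ?_ ?_⟩
      · rwa [le_div_iff₀ hη, one_mul]
      · exact div_nonpos_of_nonpos_of_nonneg hB0.le hη.le
    · have hA0 : A < 0 := sub_neg.2 (h mt mq htq)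
      have hB0 : 0 < B := sub_pos.2 (h mp mt hpt)
      refine ⟨B, hB0, fun η hη hηa => ?_⟩
      rw [abs_sub_comm]
      refine pi_div_four_le_abs_arctan_sub ?_ ?_
      · rwa [le_div_iff₀ hη, one_mul]
      · exact div_nonpos_of_nonpos_of_nonneg hA0.le hη.le
  obtain ⟨a, ha, hjump⟩ := hjump
  have hlim : Tendsto (fun η : ℝ => 4 * M * η / d ^ 2) (𝓝[>] 0) (𝓝 (4 * M * 0 / d ^ 2)) :=
    (((continuous_const.mul continuous_id).div_const (d ^ 2)).tendsto 0).mono_left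
      nhdsWithin_le_nhds
  have e1 : ∀ᶠ η : ℝ in 𝓝[>] 0, 4 * M * η / d ^ 2 < Real.pi / 4 :=
    hlim.eventually_lt_const (by simp; positivity)
  have e2 : ∀ᶠ η : ℝ in 𝓝[>] 0, η < min (min r a) (d / 2) :=
    nhdsWithin_le_nhds (Iio_mem_nhds (by positivity))
  obtain ⟨η, h1, h2, h3⟩ := (e1.and (e2.and self_mem_nhdsWithin)).exists
  have h3' : 0 < η := h3
  simp only [lt_min_iff] at h2
  have := key η h3' h2.1.1 (by nlinarith)
  linarith [hjump η h3' h2.1.2.le]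

lemma mem_closure_compl_im_ne_zero {n : ℕ} {γ : Fin n → ℝ → ℂ} {D : Set ℂ}
    (hγ : ∀ i, ContDiff ℝ 1 (γ i)) (hcl : ∀ i, γ i 0 = γ i 1)
    (hinj : ∀ i, InjOn (γ i) (Ico 0 1)) (hD : IsOpen D) (hDc : IsPreconnected D)
    (himg : (⋃ i, γ i '' Icc (0 : ℝ) 1) = frontier D) {z₀ : ℂ} (hz₀ : z₀ ∉ D) :
    z₀ ∈ closure {z | z ∉ D ∧ z.im ≠ 0} := by
  have hγD : ∀ i, ∀ t ∈ Icc (0 : ℝ) 1, γ i t ∉ D := by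
    intro i t ht h
    have : γ i t ∈ frontier D := himg ▸ mem_iUnion.2 ⟨i, t, ht, rfl⟩
    rw [hD.frontier_eq] at this
    exact this.2 h
  by_contra hcon
  rw [Metric.mem_closure_iff] at hcon
  push Not at hcon
  obtain ⟨r, hr, hcon⟩ := hcon
  have hball : ∀ z ∈ ball z₀ r, z.im ≠ 0 → z ∈ D := by
    intro z hz him
    by_contra hzD
    have := hcon z ⟨hzD, him⟩
    rw [mem_ball, dist_comm] at hz
    linarith
  have hfr : z₀ ∈ frontier D := by
    rw [hD.frontier_eq]
    refine ⟨Metric.mem_closure_iff.2 fun ε hε => ?_, hz₀⟩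
    have hm : 0 < min ε r := lt_min hε hr
    have him0 : z₀.im = 0 := by
      by_contra h
      exact hz₀ (hball z₀ (mem_ball_self hr) h)
    have hd : dist z₀ (z₀ + ((min ε r / 2 : ℝ) : ℂ) * Complex.I) = min ε r / 2 := by
      rw [dist_self_add_right, norm_mul, Complex.norm_real, Complex.norm_I, mul_one,
        Real.norm_eq_abs, abs_of_pos (by positivity)]
    refine ⟨z₀ + ((min ε r / 2 : ℝ) : ℂ) * Complex.I, hball _ ?_ ?_, ?_⟩
    · rw [mem_ball, dist_comm, hd]
      linarith [min_le_right ε r]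
    · simp only [Complex.add_im, Complex.mul_im, Complex.ofReal_re, Complex.I_im, him0]
      simp [hm.ne']
    · rw [hd]; linarith [min_le_left ε r]
  rw [← himg] at hfr
  obtain ⟨i, t, ht, hti⟩ := mem_iUnion.1 hfr
  have hcl' : t ∈ closure (Ioo (0 : ℝ) 1) := by rwa [closure_Ioo zero_ne_one]
  obtain ⟨t₀, ht₀b, ht₀⟩ := mem_closure_iff_nhds.1 hcl' (γ i ⁻¹' ball z₀ r)
    ((isOpen_ball.preimage (hγ i).continuous).mem_nhds (by simp [hti, hr]))
  have hpos : 0 < r - dist (γ i t₀) z₀ := sub_pos.2 ht₀b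
  obtain ⟨z, hz, him, hzD⟩ := exists_ball_im_ne_zero_notMem (hγ i) (hcl i) (hinj i) hD hDc (hγD i)
    ht₀ hpos
  refine hzD (hball z ?_ him)
  rw [mem_ball] at hz ⊢
  linarith [dist_triangle z (γ i t₀) z₀]

lemma eventually_notMem_of_sum_integral_eq {n : ℕ} {γ : Fin n → ℝ → ℂ}
    (hγ : ∀ i, ContDiff ℝ 1 (γ i)) {D : Set ℂ}
    (hwind : ∀ z ∈ D, (∑ i, ∫ t in (0 : ℝ)..1, deriv (γ i) t / (γ i t - z)) =
      2 * (Real.pi : ℂ) * Complex.I) : ∀ᶠ z in cocompact ℂ, z ∉ D := by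
  have h : Tendsto (fun z => ∑ i, ∫ t in (0 : ℝ)..1, deriv (γ i) t / (γ i t - z)) (cocompact ℂ)
      (𝓝 (∑ _i : Fin n, 0)) := by
    refine tendsto_finsetSum _ fun i _ => ?_
    exact tendsto_integral_div_sub_cocompact (hγ i).continuous.continuousOn
      ((hγ i).continuous_deriv le_rfl).continuousOn
  rw [Finset.sum_const_zero] at h
  have hne : (0 : ℂ) ≠ 2 * (Real.pi : ℂ) * Complex.I := Complex.two_pi_I_ne_zero.symm
  filter_upwards [h.eventually_ne hne] with z hz hzD
  exact hz (hwind z hzD)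

lemma integral_pow_mul_deriv_eq_zero {γ : ℝ → ℂ} (hγ : ContDiff ℝ 1 γ) (hcl : γ 0 = γ 1) (j : ℕ) :
    (∫ t in (0 : ℝ)..1, γ t ^ j * deriv γ t) = 0 := by
  have h : (∫ t in (0 : ℝ)..1, γ t ^ j * deriv γ t) =
      γ 1 ^ (j + 1) / (j + 1 : ℕ) - γ 0 ^ (j + 1) / (j + 1 : ℕ) := by
    apply intervalIntegral.integral_eq_sub_of_hasDerivAt
      (f := fun t => γ t ^ (j + 1) / ((j + 1 : ℕ) : ℂ))
    · intro t _
      refine HasDerivAt.congr_deriv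
        (((((hγ.differentiable one_ne_zero) t).hasDerivAt).fun_pow (j + 1)).div_const _) ?_
      have : ((j + 1 : ℕ) : ℂ) ≠ 0 := Nat.cast_ne_zero.2 j.succ_ne_zero
      field_simp
      simp [mul_comm]
    · exact ((hγ.continuous.pow j).mul (hγ.continuous_deriv le_rfl)).intervalIntegrable _ _
  rw [h, hcl, sub_self]

/-- The moments over a cycle around `D` of a function with prescribed expansion at infinity. -/
theorem sum_integral_mul_pow_eq {n : ℕ} {γ : Fin n → ℝ → ℂ}
    (hγ : ∀ i, ContDiff ℝ 1 (γ i)) (hcl : ∀ i, γ i 0 = γ i 1) {D : Set ℂ} (hD : IsOpen D)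
    (hγD : ∀ i, ∀ t ∈ Icc (0 : ℝ) 1, γ i t ∉ D)
    (hwind : ∀ z ∈ D, (∑ i, ∫ t in (0 : ℝ)..1, deriv (γ i) t / (γ i t - z)) =
      2 * (Real.pi : ℂ) * Complex.I)
    {a : ℕ → ℂ → ℂ} {b : ℕ → ℂ} (ha : ∀ z ∉ D, AnalyticAt ℂ (a 0) z)
    (hrec : ∀ k, ∀ z ∉ D, z * a k z = b k + a (k + 1) z)
    (hlim : ∀ k, Tendsto (a k) (cocompact ℂ) (𝓝 0)) (m : ℕ) :
    (∑ i, ∫ t in (0 : ℝ)..1, a 0 (γ i t) * γ i t ^ m * deriv (γ i) t) =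
      2 * (Real.pi : ℂ) * Complex.I * b m := by
  have hev := eventually_notMem_of_sum_integral_eq hγ hwind
  obtain ⟨g, hg0, hg⟩ : ∃ g : ℕ → ℂ → ℂ, g 0 = a 0 ∧ ∀ k z, g (k + 1) z = z * g k z - b k :=
    ⟨fun k => Nat.rec (a 0) (fun k f z => z * f z - b k) k, rfl, fun _ _ => rfl⟩
  have hga : ∀ k, ∀ z ∉ D, g k z = a k z := by
    intro k
    induction k with
    | zero => intro z _; rw [hg0]
    | succ k ih => intro z hz; rw [hg, ih z hz, hrec k z hz]; ring
  have hgan : ∀ k, ∀ z ∉ D, AnalyticAt ℂ (g k) z := by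
    intro k
    induction k with
    | zero => rw [hg0]; exact ha
    | succ k ih =>
      intro z hz
      have : g (k + 1) = fun z => z * g k z - b k := funext (hg k)
      rw [this]
      exact (analyticAt_id.mul (ih z hz)).sub analyticAt_const
  have hmom : ∀ j k, (∑ i, ∫ t in (0 : ℝ)..1, g k (γ i t) * γ i t ^ j * deriv (γ i) t) =
      ∑ i, ∫ t in (0 : ℝ)..1, g (k + j) (γ i t) * deriv (γ i) t := by
    intro j
    induction j with
    | zero => intro k; simp
    | succ j ih =>
      intro k
      rw [show k + (j + 1) = k + 1 + j by ring, ← ih]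
      refine Finset.sum_congr rfl fun i _ => ?_
      rw [← sub_eq_zero, ← intervalIntegral.integral_sub]
      · have e : ∀ t, g k (γ i t) * γ i t ^ (j + 1) * deriv (γ i) t -
            g (k + 1) (γ i t) * γ i t ^ j * deriv (γ i) t =
            b k * (γ i t ^ j * deriv (γ i) t) := by
          intro t; rw [hg]; ring
        simp only [e]
        rw [intervalIntegral.integral_const_mul, integral_pow_mul_deriv_eq_zero (hγ i) (hcl i),
          mul_zero]
      all_goals
        apply ContinuousOn.intervalIntegrable
        rw [uIcc_of_le zero_le_one]
        refine ContinuousOn.mul (ContinuousOn.mul ?_ ?_) ?_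
        · exact fun t ht => ((hgan _ _ (hγD i t ht)).continuousAt).comp_continuousWithinAt
            (hγ i).continuous.continuousWithinAt
        · exact ((hγ i).continuous.pow _).continuousOn
        · exact ((hγ i).continuous_deriv le_rfl).continuousOn
  rw [← hg0, hmom m 0, zero_add]
  refine sum_integral_eq_of_analyticAt_compl hγ hD hγD hwind (hgan m) ?_
  have h1 : Tendsto (fun z => b m + a (m + 1) z) (cocompact ℂ) (𝓝 (b m + 0)) :=
    tendsto_const_nhds.add (hlim (m + 1))
  rw [add_zero] at h1
  refine h1.congr' ?_
  filter_upwards [hev] with z hz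
  rw [hga m z hz, hrec m z hz]

end Cauchy

section RingRelations

variable {E : Type*} [Ring E]

lemma mul_mul_eq_of_eq {a b c : E} (h : a * b = c) (x : E) : a * (b * x) = c * x := by
  rw [← mul_assoc, h]

lemma two_mul_mul_eq_of_commutators [IsAddTorsionFree E] {R I A B C D : E}
    (hI : I * I = -1) (hA : A * A = -1) (hC : C * C = -1) (hR : R * R = -1)
    (hCI : C * I = -(I * C))
    (hDI : D * I = -(I * D)) (hBA : B * A = -(A * B)) (hCA : C * A = -(A * C))
    (hCB : C * B = -(B * C)) (hDA : D * A = -(A * D)) (hDB : D * B = -(B * D))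
    (hDC : D * C = -(C * D))
    (hIR : I * R = R * I) (hAR : A * R = R * A + (I * A - B)) (hBR : B * R = R * B + (I * B + A))
    (hCR : C * R = R * C + (I * C - D)) :
    2 * (R * I) = 1 + I * A * B + I * C * D - I * C * D * (I * A * B) := by
  have h1 : R * (I * A) - R * B = A + I * B := by
    have h := mul_assoc A R R
    simp only [hR, mul_mul_eq_of_eq hR, mul_mul_eq_of_eq hIR, hAR, hBR,
      mul_assoc, mul_add, add_mul, mul_sub, sub_mul, neg_mul, mul_neg,
      one_mul, mul_one, mul_mul_eq_of_eq hI] at h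
    rw [← sub_eq_zero]
    apply (smul_eq_zero_iff_right (two_ne_zero (α := ℕ))).1
    rw [two_nsmul]
    rw [← sub_eq_zero] at h
    rw [← h]
    abel
  have h2 : R * I + R * (I * (I * (A * B))) = 1 + I * (A * B) := by
    have h := congrArg (· * A) h1
    simp only [
      mul_assoc, add_mul, sub_mul, neg_mul, mul_neg,
      one_mul, mul_one, mul_mul_eq_of_eq hI, hA, hBA] at h ⊢
    rw [← neg_inj]
    rw [← sub_eq_zero] at h ⊢
    rw [← h]
    abel
  have h3 : R * I - R * (I * (I * (A * B))) = I * (C * D) - I * (C * (D * (I * (A * B)))) := by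
    have h := congrArg (fun y => C * y * C) h2
    simp only [mul_mul_eq_of_eq hCR,
      mul_assoc, mul_add, add_mul, sub_mul, neg_mul, mul_neg, neg_neg, neg_add_rev,
      one_mul, mul_one, mul_mul_eq_of_eq hI, hC, hCI, mul_mul_eq_of_eq hCI,
      mul_mul_eq_of_eq hCA, hCB, mul_mul_eq_of_eq hCB, hDI,
      mul_mul_eq_of_eq hDI, mul_mul_eq_of_eq hDA, hDB, hDC] at h ⊢
    rw [← sub_eq_zero] at h ⊢
    rw [← h]
    abel
  simp only [mul_assoc] at h2 h3 ⊢
  rw [two_mul]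
  linear_combination (norm := abel) h2 + h3

lemma eq_neg_mul_of_two_mul_eq [IsAddTorsionFree E] {ρ a b c x : E}
    (hab : 2 * ρ = 1 + a + b - b * a) (hac : 2 * ρ = 1 + a + c - c * a)
    (hxa : x * a = -(a * x)) (hxb : x * b = b * x) (hxc : x * c = -(c * x)) (hx : x * x = -1) :
    b = -(c * a) := by
  have h1 : b - b * a = c - c * a := by
    have := hab.symm.trans hac
    rw [← sub_eq_zero] at this ⊢
    rw [← this]; abel
  have h2' : b + b * a = -(c + c * a) := by
    have h := congrArg (fun y => x * y * x) h1
    simp only [mul_sub, sub_mul, mul_assoc, mul_mul_eq_of_eq hxb, mul_mul_eq_of_eq hxc, hxa, hxb,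
      hx, mul_neg, neg_mul, mul_one, neg_neg] at h
    rw [← sub_eq_zero] at h ⊢
    rw [← neg_eq_zero, ← h]; abel
  have h3 := congrArg₂ (· + ·) h1 h2'
  rw [← sub_eq_zero]
  apply (smul_eq_zero_iff_right (two_ne_zero (α := ℕ))).1
  rw [two_nsmul]
  rw [← sub_eq_zero] at h3
  rw [← h3]; abel

lemma triple_mul_self {a b c : E} (ha : a * a = -1) (hb : b * b = -1) (hc : c * c = -1)
    (hba : b * a = -(a * b)) (hca : c * a = -(a * c)) (hcb : c * b = -(b * c)) :
    a * b * c * (a * b * c) = 1 := by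
  simp only [mul_assoc, mul_mul_eq_of_eq hba, mul_mul_eq_of_eq hca, mul_mul_eq_of_eq hcb, ha, hb,
    hc, neg_mul, mul_neg, neg_neg, mul_one]

lemma mul_eq_neg_of_involutions {a b c : E} (ha : a * a = 1) (hb : b * b = 1)
    (hc : c * c = 1) (h : b = -(c * a)) :
    a * b = -c ∧ a * c = -b ∧ b * a = -c ∧ b * c = -a ∧ c * a = -b ∧ c * b = -a := by
  have hca : c * a = -b := by rw [h, neg_neg]
  have hba : b * a = -c := by rw [h, neg_mul, mul_assoc, ha, mul_one]
  have hcb : c * b = -a := by rw [h, mul_neg, ← mul_assoc, hc, one_mul]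
  have hbc : b * c = -a := by
    rw [← neg_eq_iff_eq_neg.2 hba, mul_neg, ← mul_assoc, hb, one_mul]
  have hab : a * b = -c := by
    rw [← neg_eq_iff_eq_neg.2 hcb, neg_mul, mul_assoc, hb, mul_one]
  have hac : a * c = -b := by
    rw [← neg_eq_iff_eq_neg.2 hab, mul_neg, ← mul_assoc, ha, one_mul]
  exact ⟨hab, hac, hba, hbc, hca, hcb⟩

end RingRelations

namespace Oct

@[simp] lemma add_a (x y : Oct) : (x + y).a = x.a + y.a := rfl
@[simp] lemma add_b (x y : Oct) : (x + y).b = x.b + y.b := rfl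
@[simp] lemma sub_a (x y : Oct) : (x - y).a = x.a - y.a := rfl
@[simp] lemma sub_b (x y : Oct) : (x - y).b = x.b - y.b := rfl
@[simp] lemma neg_a (x : Oct) : (-x).a = -x.a := rfl
@[simp] lemma neg_b (x : Oct) : (-x).b = -x.b := rfl
@[simp] lemma smul_a (r : ℝ) (x : Oct) : (r • x).a = r • x.a := rfl
@[simp] lemma smul_b (r : ℝ) (x : Oct) : (r • x).b = r • x.b := rfl
@[simp] lemma mul_a (x y : Oct) : (x * y).a = x.a * y.a - star y.b * x.b := rfl
@[simp] lemma mul_b (x y : Oct) : (x * y).b = y.b * x.a + x.b * star y.a := rfl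
@[simp] lemma zero_a : (0 : Oct).a = 0 := rfl
@[simp] lemma zero_b : (0 : Oct).b = 0 := rfl
lemma one_a : (1 : Oct).a = 1 := rfl
lemma one_b : (1 : Oct).b = 0 := rfl
@[simp] lemma conj_a (x : Oct) : (conj x).a = star x.a := rfl
@[simp] lemma conj_b (x : Oct) : (conj x).b = -x.b := rfl

protected lemma add_mul (x y z : Oct) : (x + y) * z = x * z + y * z := by
  ext1 <;> simp [add_mul, mul_add] <;> abel

protected lemma mul_add (x y z : Oct) : x * (y + z) = x * y + x * z := by
  ext1 <;> simp [add_mul, mul_add] <;> abel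

protected lemma smul_mul (r : ℝ) (x y : Oct) : (r • x) * y = r • (x * y) := by
  ext1 <;> simp [smul_sub]

protected lemma mul_smul (r : ℝ) (x y : Oct) : x * (r • y) = r • (x * y) := by
  ext1 <;> simp [smul_sub]

protected lemma one_mul (x : Oct) : 1 * x = x := by ext1 <;> simp [one_a, one_b]
protected lemma mul_one (x : Oct) : x * 1 = x := by ext1 <;> simp [one_a, one_b]

lemma ext_components {x y : Oct} (h0 : x.a.re = y.a.re) (h1 : x.a.imI = y.a.imI)
    (h2 : x.a.imJ = y.a.imJ) (h3 : x.a.imK = y.a.imK) (h4 : x.b.re = y.b.re)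
    (h5 : x.b.imI = y.b.imI) (h6 : x.b.imJ = y.b.imJ) (h7 : x.b.imK = y.b.imK) : x = y :=
  Oct.ext (QuaternionAlgebra.ext h0 h1 h2 h3) (QuaternionAlgebra.ext h4 h5 h6 h7)

@[simp] lemma e_a_re (i : Fin 8) : (e i).a.re = if i = 0 then 1 else 0 := by
  fin_cases i <;> rfl

@[simp] lemma e_a_imI (i : Fin 8) : (e i).a.imI = if i = 1 then 1 else 0 := by
  fin_cases i <;> rfl

@[simp] lemma e_a_imJ (i : Fin 8) : (e i).a.imJ = if i = 2 then 1 else 0 := by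
  fin_cases i <;> rfl

@[simp] lemma e_a_imK (i : Fin 8) : (e i).a.imK = if i = 3 then 1 else 0 := by
  fin_cases i <;> rfl

@[simp] lemma e_b_re (i : Fin 8) : (e i).b.re = if i = 4 then 1 else 0 := by
  fin_cases i <;> rfl

@[simp] lemma e_b_imI (i : Fin 8) : (e i).b.imI = if i = 5 then 1 else 0 := by
  fin_cases i <;> rfl

@[simp] lemma e_b_imJ (i : Fin 8) : (e i).b.imJ = if i = 6 then 1 else 0 := by
  fin_cases i <;> rfl

@[simp] lemma e_b_imK (i : Fin 8) : (e i).b.imK = if i = 7 then 1 else 0 := by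
  fin_cases i <;> rfl

@[simp] lemma one_a_re : (1 : Oct).a.re = 1 := rfl
@[simp] lemma one_a_imI : (1 : Oct).a.imI = 0 := rfl
@[simp] lemma one_a_imJ : (1 : Oct).a.imJ = 0 := rfl
@[simp] lemma one_a_imK : (1 : Oct).a.imK = 0 := rfl
@[simp] lemma one_b_re : (1 : Oct).b.re = 0 := rfl
@[simp] lemma one_b_imI : (1 : Oct).b.imI = 0 := rfl
@[simp] lemma one_b_imJ : (1 : Oct).b.imJ = 0 := rfl
@[simp] lemma one_b_imK : (1 : Oct).b.imK = 0 := rfl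

/-- The real coordinates of an octonion with respect to `e`. -/
def coord (x : Oct) : Fin 8 → ℝ :=
  ![x.a.re, x.a.imI, x.a.imJ, x.a.imK, x.b.re, x.b.imI, x.b.imJ, x.b.imK]

lemma e_zero : e 0 = 1 := rfl

lemma sum_coord_smul_e (x : Oct) : ∑ i, coord x i • e i = x := by
  rw [Fin.sum_univ_eight]
  apply ext_components <;> simp [coord]

lemma re_mul_conj_e (x : Oct) (i : Fin 8) : re (x * conj (e i)) = coord x i := by
  fin_cases i <;> simp [coord, re, Quaternion.re_mul]

lemma re_mul_comm (x y : Oct) : re (x * y) = re (y * x) := by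
  simp only [re, mul_a, Quaternion.re_sub, Quaternion.re_mul, Quaternion.re_star,
    Quaternion.imI_star, Quaternion.imJ_star, Quaternion.imK_star]
  ring

lemma re_mul_assoc (x y z : Oct) : re ((x * y) * z) = re (x * (y * z)) := by
  simp only [re, mul_a, mul_b, Quaternion.re_sub, Quaternion.re_mul, Quaternion.re_star,
    Quaternion.imI_star, Quaternion.imJ_star, Quaternion.imK_star, Quaternion.imI_sub,
    Quaternion.imI_mul, Quaternion.imJ_sub, Quaternion.imJ_mul, Quaternion.imK_sub,
    Quaternion.imK_mul, Quaternion.re_add, Quaternion.imI_add, Quaternion.imJ_add,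
    Quaternion.imK_add]
  ring

lemma re_one : re 1 = 1 := rfl

lemma e_succ_mul_self (i : Fin 7) : e i.succ * e i.succ = -1 := by
  fin_cases i <;> apply ext_components <;> simp [Quaternion.re_mul]

lemma mul_comm_of_orthogonal {x y : Oct} (hx : x.a.re = 0) (hy : y.a.re = 0)
    (h : x.a.imI * y.a.imI + x.a.imJ * y.a.imJ + x.a.imK * y.a.imK + x.b.re * y.b.re +
      x.b.imI * y.b.imI + x.b.imJ * y.b.imJ + x.b.imK * y.b.imK = 0) : y * x = -(x * y) := by
  apply ext_components <;> simp [Quaternion.re_mul, hx, hy]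
  case h0 => linear_combination -2 * h
  all_goals ring

lemma e_succ_mul_comm {i j : Fin 7} (h : i ≠ j) :
    e j.succ * e i.succ = -(e i.succ * e j.succ) := by
  refine mul_comm_of_orthogonal (by simp) (by simp) ?_
  simp only [e_a_imI, e_a_imJ, e_a_imK, e_b_re, e_b_imI, e_b_imJ, e_b_imK, mul_ite, mul_one,
    mul_zero]
  have h' : j.succ ≠ i.succ := fun h' => h (Fin.succ_injective 7 h').symm
  have key : ∀ k : Fin 8, (if j.succ = k then if i.succ = k then (1 : ℝ) else 0 else 0) = 0 := by
    intro k
    split_ifs with h1 h2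
    · exact absurd (h1.trans h2.symm) h'
    · rfl
    · rfl
  simp only [key, add_zero]

/-- Oriented triples of imaginary units spanning a quaternion subalgebra. -/
structure IsLine (i j k : Fin 7) : Prop where
  left : e i.succ * e j.succ = e k.succ
  right : e i.succ * e k.succ = -e j.succ
  cyc : e j.succ * e k.succ = e i.succ

/-- The oriented lines of the Fano plane underlying the multiplication table of `e`. -/
def fanoLine : Fin 7 → Fin 7 × Fin 7 × Fin 7 :=
  ![(0, 1, 2), (0, 3, 4), (0, 6, 5), (1, 3, 5), (1, 4, 6), (2, 3, 6), (2, 5, 4)]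

lemma isLine_fanoLine (l : Fin 7) : IsLine (fanoLine l).1 (fanoLine l).2.1 (fanoLine l).2.2 := by
  fin_cases l <;> constructor <;> apply ext_components <;> simp [fanoLine, Quaternion.re_mul]

lemma IsLine.rotate {i j k : Fin 7} (h : IsLine i j k) (hij : i ≠ j) (hik : i ≠ k) :
    IsLine j k i where
  left := h.cyc
  right := by rw [e_succ_mul_comm hij, h.left]
  cyc := by rw [e_succ_mul_comm hik, h.right, neg_neg]

/-- The lines of the Fano plane through a given point, as oriented triples starting there. -/
def fanoPencil : Fin 7 → Fin 3 → Fin 7 × Fin 7 × Fin 7 :=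
  ![![(0, 1, 2), (0, 3, 4), (0, 6, 5)], ![(1, 2, 0), (1, 3, 5), (1, 4, 6)],
    ![(2, 0, 1), (2, 3, 6), (2, 5, 4)], ![(3, 4, 0), (3, 5, 1), (3, 6, 2)],
    ![(4, 0, 3), (4, 6, 1), (4, 2, 5)], ![(5, 0, 6), (5, 1, 3), (5, 4, 2)],
    ![(6, 5, 0), (6, 1, 4), (6, 2, 3)]]

/-- The number of the `n`-th line through a given point. -/
def fanoIndex : Fin 7 → Fin 3 → Fin 7 :=
  ![![0, 1, 2], ![0, 3, 4], ![0, 5, 6], ![1, 3, 5], ![1, 4, 6], ![2, 3, 6], ![2, 4, 5]]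

end Oct

section FanoOperators

variable {V : Type*} [NormedAddCommGroup V] [NormedSpace ℝ V] [OctBimodule V]

lemma lmo_add (p q : Oct) : (lmo (p + q) : V →L[ℝ] V) = lmo p + lmo q := map_add _ _ _
lemma lmo_smul (r : ℝ) (p : Oct) : (lmo (r • p) : V →L[ℝ] V) = r • lmo p := map_smul _ _ _
lemma lmo_neg (p : Oct) : (lmo (-p) : V →L[ℝ] V) = -lmo p := map_neg _ _
lemma lmo_sum {ι : Type*} (s : Finset ι) (f : ι → Oct) :
    (lmo (∑ i ∈ s, f i) : V →L[ℝ] V) = ∑ i ∈ s, lmo (f i) := map_sum _ _ _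
lemma rmo_add (p q : Oct) : (rmo (p + q) : V →L[ℝ] V) = rmo p + rmo q := map_add _ _ _
lemma rmo_smul (r : ℝ) (p : Oct) : (rmo (r • p) : V →L[ℝ] V) = r • rmo p := map_smul _ _ _
lemma rmo_neg (p : Oct) : (rmo (-p) : V →L[ℝ] V) = -rmo p := map_neg _ _
lemma rmo_sum {ι : Type*} (s : Finset ι) (f : ι → Oct) :
    (rmo (∑ i ∈ s, f i) : V →L[ℝ] V) = ∑ i ∈ s, rmo (f i) := map_sum _ _ _
lemma lmo_one : (lmo 1 : V →L[ℝ] V) = 1 := ContinuousLinearMap.ext OctBimodule.lm_one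
lemma rmo_one : (rmo 1 : V →L[ℝ] V) = 1 := ContinuousLinearMap.ext OctBimodule.rm_one

lemma lmo_mul_sub (p q : Oct) : (lmo (p * q) - lmo p * lmo q : V →L[ℝ] V) =
    rmo p * lmo q - lmo q * rmo p := ContinuousLinearMap.ext (OctBimodule.assoc_cyc₁ p q)

lemma lmo_mul_sub' (p q : Oct) : (lmo (p * q) - lmo p * lmo q : V →L[ℝ] V) =
    rmo q * rmo p - rmo (p * q) := ContinuousLinearMap.ext (OctBimodule.assoc_cyc₂ p q)

lemma lmo_mul_sub_alt (p q : Oct) : (lmo (p * q) - lmo p * lmo q : V →L[ℝ] V) =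
    -(lmo (q * p) - lmo q * lmo p) := ContinuousLinearMap.ext (OctBimodule.assoc_alt p q)

lemma isAddTorsionFree_clm : IsAddTorsionFree (V →L[ℝ] V) := .of_isTorsionFree ℝ _

lemma lmo_mul_self (p : Oct) : (lmo p * lmo p : V →L[ℝ] V) = lmo (p * p) := by
  have := isAddTorsionFree_clm (V := V)
  have h := lmo_mul_sub_alt (V := V) p p
  rw [self_eq_neg, sub_eq_zero] at h
  exact h.symm

lemma rmo_mul_self (p : Oct) : (rmo p * rmo p : V →L[ℝ] V) = rmo (p * p) := by
  have h := lmo_mul_sub' (V := V) p p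
  rw [lmo_mul_self, sub_self] at h
  exact sub_eq_zero.1 h.symm

lemma lmo_comm_rmo (p : Oct) : (lmo p * rmo p : V →L[ℝ] V) = rmo p * lmo p := by
  have h := lmo_mul_sub (V := V) p p
  rw [lmo_mul_self, sub_self] at h
  exact (sub_eq_zero.1 h.symm).symm

lemma lmo_anticomm {p q : Oct} (h : q * p = -(p * q)) :
    (lmo q * lmo p : V →L[ℝ] V) = -(lmo p * lmo q) := by
  have h1 := lmo_mul_sub_alt (V := V) p q
  rw [h, lmo_neg] at h1
  rw [← sub_eq_zero] at h1 ⊢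
  rw [← neg_eq_zero, ← h1]; abel

lemma lmo_e_mul_self (i : Fin 7) : (lmo (e i.succ) * lmo (e i.succ) : V →L[ℝ] V) = -1 := by
  rw [lmo_mul_self, e_succ_mul_self, lmo_neg, lmo_one]

lemma rmo_e_mul_self (i : Fin 7) : (rmo (e i.succ) * rmo (e i.succ) : V →L[ℝ] V) = -1 := by
  rw [rmo_mul_self, e_succ_mul_self, rmo_neg, rmo_one]

lemma lmo_e_anticomm {i j : Fin 7} (h : i ≠ j) :
    (lmo (e j.succ) * lmo (e i.succ) : V →L[ℝ] V) = -(lmo (e i.succ) * lmo (e j.succ)) :=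
  lmo_anticomm (e_succ_mul_comm h)

lemma lmo_mul_rmo_of_mul_eq {p q r : Oct} (h : p * q = r) :
    (lmo q * rmo p : V →L[ℝ] V) = rmo p * lmo q + (lmo p * lmo q - lmo r) := by
  have h1 := lmo_mul_sub (V := V) p q
  rw [h] at h1
  rw [← sub_eq_zero] at h1 ⊢
  rw [← h1]; abel

variable (V) in
/-- The operator `e_i (e_j (e_k ·))` attached to an oriented triple of imaginary units. -/
def fanoOp (i j k : Fin 7) : V →L[ℝ] V := lmo (e i.succ) * lmo (e j.succ) * lmo (e k.succ)

lemma fanoOp_rotate {i j k : Fin 7} (hij : i ≠ j) (hik : i ≠ k) :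
    fanoOp V j k i = fanoOp V i j k := by
  simp only [fanoOp, mul_assoc]
  rw [lmo_e_anticomm hik, mul_neg, mul_mul_eq_of_eq (lmo_e_anticomm hij), neg_mul, neg_neg,
    mul_assoc]

lemma two_mul_rmo_mul_lmo {i a b c d : Fin 7} (h₁ : IsLine i a b) (h₂ : IsLine i c d)
    (hn : [i, a, b, c, d].Nodup) :
    2 * (rmo (e i.succ) * lmo (e i.succ)) = 1 + fanoOp V i a b + fanoOp V i c d -
      fanoOp V i c d * fanoOp V i a b := by
  have := isAddTorsionFree_clm (V := V)
  simp only [List.nodup_cons, List.mem_cons, List.not_mem_nil, or_false, not_or] at hn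
  obtain ⟨⟨h1, h2, h3, h4⟩, ⟨h5, h6, h7⟩, ⟨h8, h9⟩, h10, -⟩ := hn
  have := lmo_mul_rmo_of_mul_eq (V := V) h₁.right
  rw [lmo_neg, sub_neg_eq_add] at this
  exact two_mul_mul_eq_of_commutators (lmo_e_mul_self _) (lmo_e_mul_self _)
    (lmo_e_mul_self _) (rmo_e_mul_self _)
    (lmo_e_anticomm h3) (lmo_e_anticomm h4) (lmo_e_anticomm h5) (lmo_e_anticomm h6)
    (lmo_e_anticomm h8) (lmo_e_anticomm h7) (lmo_e_anticomm h9) (lmo_e_anticomm h10)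
    (lmo_comm_rmo _) (lmo_mul_rmo_of_mul_eq h₁.left) this (lmo_mul_rmo_of_mul_eq h₂.left)

lemma lmo_mul_fanoOp_of_ne {x i j k : Fin 7} (hi : x ≠ i) (hj : x ≠ j) (hk : x ≠ k) :
    lmo (e x.succ) * fanoOp V i j k = -(fanoOp V i j k * lmo (e x.succ)) := by
  simp only [fanoOp, mul_assoc, mul_mul_eq_of_eq (lmo_e_anticomm (V := V) (Ne.symm hi)),
    mul_mul_eq_of_eq (lmo_e_anticomm (V := V) (Ne.symm hj)), lmo_e_anticomm (V := V) (Ne.symm hk), neg_mul, mul_neg,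
    neg_neg]

lemma lmo_mul_fanoOp_left {i j k : Fin 7} (hij : i ≠ j) (hik : i ≠ k) :
    lmo (e i.succ) * fanoOp V i j k = fanoOp V i j k * lmo (e i.succ) := by
  simp only [fanoOp, mul_assoc, mul_mul_eq_of_eq (lmo_e_anticomm (V := V) hij), lmo_e_anticomm (V := V) hik, neg_mul,
    mul_neg, neg_neg]

lemma fanoOp_mul_self {i j k : Fin 7} (hij : i ≠ j) (hik : i ≠ k) (hjk : j ≠ k) :
    fanoOp V i j k * fanoOp V i j k = 1 :=
  triple_mul_self (lmo_e_mul_self _) (lmo_e_mul_self _) (lmo_e_mul_self _) (lmo_e_anticomm hij)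
    (lmo_e_anticomm hik) (lmo_e_anticomm hjk)

lemma fanoOp_eq_neg_mul {i a b c d f g : Fin 7} (h₁ : IsLine i a b) (h₂ : IsLine i c d)
    (h₃ : IsLine i f g) (hn : [i, a, b, c, d, f, g].Nodup) :
    fanoOp V i c d = -(fanoOp V i f g * fanoOp V i a b) := by
  have := isAddTorsionFree_clm (V := V)
  have hn' := hn
  simp only [List.nodup_cons, List.mem_cons, List.not_mem_nil, or_false, not_or] at hn'
  obtain ⟨⟨-, -, hic, hid, -, -⟩, ⟨-, hac, -⟩, ⟨hbc, -⟩, ⟨hcd, hcf, hcg⟩, -⟩ := hn'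
  refine eq_neg_mul_of_two_mul_eq (x := lmo (e c.succ)) (two_mul_rmo_mul_lmo h₁ h₂ ?_)
    (two_mul_rmo_mul_lmo h₁ h₃ ?_) ?_ ?_ ?_ (lmo_e_mul_self c)
  · exact hn.sublist (by simp)
  · exact hn.sublist (List.Sublist.cons_cons _ (List.Sublist.cons_cons _ (List.Sublist.cons_cons _
      (List.Sublist.cons _ (List.Sublist.cons _ (List.Sublist.refl _))))))
  · exact lmo_mul_fanoOp_of_ne (Ne.symm hic) (Ne.symm hac) (Ne.symm hbc)
  · rw [← fanoOp_rotate hic hid]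
    exact lmo_mul_fanoOp_left hcd (Ne.symm hic)
  · exact lmo_mul_fanoOp_of_ne (Ne.symm hic) hcf hcg

/-- The products of the three operators attached to the lines through a point. -/
lemma fanoOp_pencil {i a b c d f g : Fin 7} (h₁ : IsLine i a b) (h₂ : IsLine i c d)
    (h₃ : IsLine i f g) (hn : [i, a, b, c, d, f, g].Nodup) {s t u : V →L[ℝ] V}
    (hs : fanoOp V i a b = s) (ht : fanoOp V i c d = t) (hu : fanoOp V i f g = u) :
    (s * t = -u ∧ s * u = -t ∧ t * s = -u ∧ t * u = -s ∧ u * s = -t ∧ u * t = -s) ∧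
      2 * (rmo (e i.succ) * lmo (e i.succ)) = 1 + s + t + u := by
  subst hs ht hu
  have hn' := hn
  simp only [List.nodup_cons, List.mem_cons, List.not_mem_nil, or_false, not_or] at hn'
  obtain ⟨⟨hia, hib, hic, hid, hif, hig⟩, ⟨hab, -⟩, -, ⟨hcd, -⟩, -, hfg, -⟩ := hn'
  have key := mul_eq_neg_of_involutions (fanoOp_mul_self (V := V) hia hib hab)
    (fanoOp_mul_self hic hid hcd) (fanoOp_mul_self hif hig hfg) (fanoOp_eq_neg_mul h₁ h₂ h₃ hn)
  refine ⟨key, ?_⟩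
  rw [two_mul_rmo_mul_lmo h₁ h₂ (hn.sublist (by simp)), key.2.2.1, sub_neg_eq_add]

variable (V) in
/-- The operator attached to a line of the Fano plane. -/
def lineOp (l : Fin 7) : V →L[ℝ] V :=
  fanoOp V (fanoLine l).1 (fanoLine l).2.1 (fanoLine l).2.2

lemma fanoPencil_spec (i : Fin 7) (n : Fin 3) :
    (fanoPencil i n).1 = i ∧ (fanoPencil i n = fanoLine (fanoIndex i n) ∨
      fanoPencil i n = ((fanoLine (fanoIndex i n)).2.1, (fanoLine (fanoIndex i n)).2.2,
        (fanoLine (fanoIndex i n)).1) ∨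
      fanoPencil i n = ((fanoLine (fanoIndex i n)).2.2, (fanoLine (fanoIndex i n)).1,
        (fanoLine (fanoIndex i n)).2.1)) := by
  revert i n; decide

lemma fanoLine_ne (l : Fin 7) : (fanoLine l).1 ≠ (fanoLine l).2.1 ∧
    (fanoLine l).1 ≠ (fanoLine l).2.2 ∧ (fanoLine l).2.1 ≠ (fanoLine l).2.2 := by
  revert l; decide

lemma fanoPencil_isLine (i : Fin 7) (n : Fin 3) :
    IsLine i (fanoPencil i n).2.1 (fanoPencil i n).2.2 ∧
      fanoOp V i (fanoPencil i n).2.1 (fanoPencil i n).2.2 = lineOp V (fanoIndex i n) := by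
  obtain ⟨h1, h2⟩ := fanoPencil_spec i n
  suffices IsLine (fanoPencil i n).1 (fanoPencil i n).2.1 (fanoPencil i n).2.2 ∧
      fanoOp V (fanoPencil i n).1 (fanoPencil i n).2.1 (fanoPencil i n).2.2 =
        lineOp V (fanoIndex i n) by rwa [h1] at this
  obtain ⟨hab, hac, hbc⟩ := fanoLine_ne (fanoIndex i n)
  have hl := isLine_fanoLine (fanoIndex i n)
  rcases h2 with h | h | h <;> rw [h]
  · exact ⟨hl, rfl⟩
  · exact ⟨hl.rotate hab hac, fanoOp_rotate hab hac⟩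
  · exact ⟨(hl.rotate hab hac).rotate hbc hab.symm,
      (fanoOp_rotate hbc hab.symm).trans (fanoOp_rotate hab hac)⟩

lemma lineOp_pencil (i : Fin 7) {l m n : Fin 7} (hl : fanoIndex i 0 = l) (hm : fanoIndex i 1 = m)
    (hn : fanoIndex i 2 = n) :
    (lineOp V l * lineOp V m = -lineOp V n ∧ lineOp V l * lineOp V n = -lineOp V m ∧
      lineOp V m * lineOp V l = -lineOp V n ∧ lineOp V m * lineOp V n = -lineOp V l ∧
      lineOp V n * lineOp V l = -lineOp V m ∧ lineOp V n * lineOp V m = -lineOp V l) ∧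
      2 * (rmo (e i.succ) * lmo (e i.succ)) = 1 + lineOp V l + lineOp V m + lineOp V n := by
  subst hl hm hn
  refine fanoOp_pencil (fanoPencil_isLine (V := V) i 0).1 (fanoPencil_isLine (V := V) i 1).1
    (fanoPencil_isLine (V := V) i 2).1 ?_ (fanoPencil_isLine i 0).2 (fanoPencil_isLine i 1).2
    (fanoPencil_isLine i 2).2
  revert i; decide

lemma lineOp_mul_self (l : Fin 7) : lineOp V l * lineOp V l = 1 :=
  have h := fanoLine_ne l
  fanoOp_mul_self h.1 h.2.1 h.2.2

lemma reO_eq : reO V = (1 / 8 : ℝ) • (1 - ∑ l, lineOp V l) := by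
  have key (i : Fin 7) : rmo (e i.succ) * lmo (e i.succ) = (1 / 2 : ℝ) • (1 +
      lineOp V (fanoIndex i 0) + lineOp V (fanoIndex i 1) + lineOp V (fanoIndex i 2)) := by
    rw [← (lineOp_pencil i rfl rfl rfl).2, two_mul, ← two_smul ℝ, smul_smul]
    norm_num
  have h : reO V = (5 / 12 : ℝ) • (1 : V →L[ℝ] V) -
      (1 / 12 : ℝ) • ∑ i : Fin 7, rmo (e i.succ) * lmo (e i.succ) := rfl
  rw [h]
  simp only [key, Fin.sum_univ_seven, fanoIndex]
  simp only [Matrix.cons_val]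
  module

lemma lineOp_mul_reO (l : Fin 7) : lineOp V l * reO V = -reO V := by
  have h0 := (lineOp_pencil (V := V) 0 rfl rfl rfl).1
  have h1 := (lineOp_pencil (V := V) 1 rfl rfl rfl).1
  have h2 := (lineOp_pencil (V := V) 2 rfl rfl rfl).1
  have h3 := (lineOp_pencil (V := V) 3 rfl rfl rfl).1
  have h4 := (lineOp_pencil (V := V) 4 rfl rfl rfl).1
  have h5 := (lineOp_pencil (V := V) 5 rfl rfl rfl).1
  have h6 := (lineOp_pencil (V := V) 6 rfl rfl rfl).1
  have hs := lineOp_mul_self (V := V)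
  simp only [fanoIndex, Matrix.cons_val] at h0 h1 h2 h3 h4 h5 h6
  rw [reO_eq, mul_smul_comm, ← smul_neg]
  congr 1
  rw [mul_sub, mul_one, Finset.mul_sum]
  fin_cases l <;> simp only [Fin.sum_univ_seven, Fin.mk_zero, Fin.mk_one, Fin.reduceFinMk, hs, h0,
    h1, h2, h3, h4, h5, h6] <;> abel

end FanoOperators

lemma Oct.real_part_formula (p : Oct) :
    (5 / 12 : ℝ) • p - (1 / 12 : ℝ) • ∑ i : Fin 7, e i.succ * p * e i.succ = re p • (1 : Oct) := by
  apply ext_components <;> simp [Fin.sum_univ_seven, Quaternion.re_mul, re] <;> ring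

lemma Oct.mul_eq_sum (p q : Oct) :
    p * q = ∑ i, ∑ j, coord q j • coord p i • (e i * e j) := by
  have hsum_mul (s : Fin 8 → Oct) (y : Oct) : (∑ i, s i) * y = ∑ i, s i * y :=
    map_sum (⟨⟨(· * y), by ext1 <;> simp⟩, fun a b => Oct.add_mul a b y⟩ : Oct →+ Oct) s _
  have hmul_sum (s : Fin 8 → Oct) (y : Oct) : y * (∑ i, s i) = ∑ i, y * s i :=
    map_sum (⟨⟨(y * ·), by ext1 <;> simp⟩, fun a b => Oct.mul_add y a b⟩ : Oct →+ Oct) s _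
  conv_lhs => rw [← sum_coord_smul_e p, ← sum_coord_smul_e q]
  simp only [hsum_mul, hmul_sum, Oct.smul_mul, Oct.mul_smul]

lemma exists_fanoPencil : ∀ i j : Fin 7, i ≠ j → ∃ (n : Fin 3) (k : Fin 7), i ≠ k ∧ j ≠ k ∧
    (fanoPencil i n = (i, j, k) ∨ fanoPencil i n = (i, k, j)) := by
  decide

section RealPart

variable {V : Type*} [NormedAddCommGroup V] [NormedSpace ℝ V] [OctBimodule V]

lemma lmo_mul_lmo_mul_reO_e (i j : Fin 7) :
    lmo (e i.succ * e j.succ) * reO V = lmo (e i.succ) * (lmo (e j.succ) * reO V) := by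
  rcases eq_or_ne i j with rfl | hij
  · rw [e_succ_mul_self, mul_mul_eq_of_eq (lmo_e_mul_self i), lmo_neg, lmo_one]
  obtain ⟨n, k, hik, hjk, h⟩ := exists_fanoPencil i j hij
  obtain ⟨h1, h2⟩ := fanoPencil_isLine (V := V) i n
  have h3 : fanoOp V i (fanoPencil i n).2.1 (fanoPencil i n).2.2 * reO V = -reO V := by
    rw [h2, lineOp_mul_reO]
  have hk := lmo_e_mul_self (V := V) k
  rcases h with h | h <;> simp only [h] at h1 h3
  · rw [h1.left]
    have h4 : lmo (e k.succ) * (lmo (e i.succ) * (lmo (e j.succ) * reO V)) = -reO V := by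
      rw [← h3, ← fanoOp_rotate hij hik, ← fanoOp_rotate hjk hij.symm]
      simp only [fanoOp, mul_assoc]
    rw [← neg_inj, ← mul_neg, ← h4, mul_mul_eq_of_eq hk, neg_one_mul]
  · have h5 : e i.succ * e j.succ = -e k.succ := h1.right
    have h4 : lmo (e k.succ) * (lmo (e i.succ) * (lmo (e j.succ) * reO V)) = reO V := by
      rw [mul_mul_eq_of_eq (lmo_e_anticomm hik), ← neg_inj, ← h3]
      simp only [fanoOp, mul_assoc, neg_mul, neg_neg]
    rw [h5, lmo_neg, neg_mul]
    nth_rw 1 [← h4]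
    rw [mul_mul_eq_of_eq hk, neg_one_mul, neg_neg]

lemma lmo_mul_lmo_mul_reO (p q : Oct) : lmo (p * q) * reO V = lmo p * (lmo q * reO V) := by
  have key (i j : Fin 8) : lmo (e i * e j) * reO V = lmo (e i) * (lmo (e j) * reO V) := by
    induction i using Fin.cases with
    | zero => rw [e_zero, Oct.one_mul, lmo_one, one_mul]
    | succ i =>
      induction j using Fin.cases with
      | zero => rw [e_zero, Oct.mul_one, lmo_one, one_mul]
      | succ j => exact lmo_mul_lmo_mul_reO_e i j
  conv_rhs => rw [← sum_coord_smul_e p, ← sum_coord_smul_e q]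
  rw [Oct.mul_eq_sum]
  simp only [lmo_sum, lmo_smul, Finset.sum_mul, Finset.mul_sum, Finset.smul_sum, smul_mul_assoc,
    mul_smul_comm, key]
  rw [Finset.sum_comm]

lemma rmo_mul_reO_e (i : Fin 7) : rmo (e i.succ) * reO V = lmo (e i.succ) * reO V := by
  have h := (lineOp_pencil (V := V) i rfl rfl rfl).2
  have h1 : (2 : ℝ) • (rmo (e i.succ) * (lmo (e i.succ) * reO V)) = (2 : ℝ) • -reO V := by
    rw [two_smul, ← mul_assoc, ← add_mul, ← two_mul, h]
    simp only [add_mul, lineOp_mul_reO, one_mul]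
    module
  have h2 := smul_right_injective (V →L[ℝ] V) (two_ne_zero (α := ℝ)) h1
  rw [← neg_inj, ← mul_neg, ← h2, mul_mul_eq_of_eq (rmo_e_mul_self i), neg_one_mul]

lemma rmo_mul_reO (p : Oct) : rmo p * reO V = lmo p * reO V := by
  rw [← sum_coord_smul_e p]
  simp only [lmo_sum, lmo_smul, rmo_sum, rmo_smul, Finset.sum_mul, smul_mul_assoc]
  refine Finset.sum_congr rfl fun i _ => ?_
  induction i using Fin.cases with
  | zero => rw [e_zero, lmo_one, rmo_one]
  | succ i => rw [rmo_mul_reO_e]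

lemma reO_mem (x : V) : reO V x ∈ ReSet V :=
  ⟨fun p q => DFunLike.congr_fun (lmo_mul_lmo_mul_reO p q) x,
    fun p => (DFunLike.congr_fun (rmo_mul_reO p) x).symm⟩

lemma lmo_mul_lineOp_mul_lmo (i l : Fin 7) :
    lmo (e i.succ) * (lineOp V l * lmo (e i.succ)) =
      if i = (fanoLine l).1 ∨ i = (fanoLine l).2.1 ∨ i = (fanoLine l).2.2 then -lineOp V l
      else lineOp V l := by
  obtain ⟨hab, hac, hbc⟩ := fanoLine_ne l
  have hi := lmo_e_mul_self (V := V) i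
  split_ifs with h
  · have : lmo (e i.succ) * lineOp V l = lineOp V l * lmo (e i.succ) := by
      rcases h with h | h | h <;> rw [h, lineOp]
      · exact lmo_mul_fanoOp_left hab hac
      · rw [← fanoOp_rotate hab hac]
        exact lmo_mul_fanoOp_left hbc hab.symm
      · rw [← fanoOp_rotate hab hac, ← fanoOp_rotate hbc hab.symm]
        exact lmo_mul_fanoOp_left hac.symm hbc.symm
    rw [← this, mul_mul_eq_of_eq hi, neg_one_mul]
  · push Not at h
    rw [mul_mul_eq_of_eq (lmo_mul_fanoOp_of_ne h.1 h.2.1 h.2.2), neg_mul, mul_assoc, hi, mul_neg,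
      neg_neg, mul_one]
    rfl

lemma reO_sub_sum : reO V - ∑ i : Fin 7, lmo (e i.succ) * (reO V * lmo (e i.succ)) = 1 := by
  have key (l : Fin 7) :
      ∑ i : Fin 7, lmo (e i.succ) * (lineOp V l * lmo (e i.succ)) = lineOp V l := by
    simp only [lmo_mul_lineOp_mul_lmo]
    fin_cases l <;> simp [fanoLine, Fin.sum_univ_seven]
  have h : ∑ i : Fin 7, lmo (e i.succ) * (reO V * lmo (e i.succ)) =
      (1 / 8 : ℝ) • (-(7 : ℝ) • (1 : V →L[ℝ] V) - ∑ l, lineOp V l) := by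
    simp only [reO_eq, smul_mul_assoc, mul_smul_comm, ← Finset.smul_sum, sub_mul, mul_sub,
      Finset.sum_mul, Finset.mul_sum, Finset.sum_sub_distrib, one_mul, lmo_e_mul_self]
    rw [Finset.sum_comm]
    simp only [key]
    congr 2
    simp only [Finset.sum_const, Finset.card_univ, Fintype.card_fin]
    module
  rw [h, reO_eq]
  module

lemma clm_ext_of_reSet {W : Type*} [NormedAddCommGroup W] [NormedSpace ℝ W] {A B : V →L[ℝ] W}
    (h : ∀ p, ∀ v ∈ ReSet V, A (lmo p v) = B (lmo p v)) : A = B := by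
  ext x
  have hx : x = lmo 1 (reO V x) - ∑ i : Fin 7, lmo (e i.succ) (reO V (lmo (e i.succ) x)) := by
    have := DFunLike.congr_fun (reO_sub_sum (V := V)) x
    rw [lmo_one]
    simpa using this.symm
  rw [hx, map_sub, map_sub, map_sum, map_sum, h _ _ (reO_mem _)]
  congr 1
  exact Finset.sum_congr rfl fun i _ => h _ _ (reO_mem _)

section ReSetLemmas

variable {v : V}

lemma rmo_of_mem (hv : v ∈ ReSet V) (p : Oct) : rmo p v = lmo p v := (hv.2 p).symm

lemma lmo_lmo_of_mem (hv : v ∈ ReSet V) (p q : Oct) : lmo p (lmo q v) = lmo (p * q) v :=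
  (hv.1 p q).symm

lemma rmo_lmo_of_mem (hv : v ∈ ReSet V) (p q : Oct) : rmo p (lmo q v) = lmo (q * p) v := by
  have h := OctBimodule.assoc_cyc₁ p q v
  have h1 : OctBimodule.lm (p * q) v - OctBimodule.lm p (OctBimodule.lm q v) = 0 :=
    sub_eq_zero.2 (hv.1 p q)
  rw [h1] at h
  refine (sub_eq_zero.1 h.symm).trans ?_
  exact (congrArg (lmo q) (rmo_of_mem hv p)).trans (lmo_lmo_of_mem hv q p)

lemma rmo_rmo_of_mem (hv : v ∈ ReSet V) (p q : Oct) : rmo p (rmo q v) = rmo (q * p) v := by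
  rw [rmo_of_mem hv, rmo_lmo_of_mem hv, rmo_of_mem hv]

lemma reO_lmo_of_mem (hv : v ∈ ReSet V) (p : Oct) : reO V (lmo p v) = re p • v := by
  have h : reO V (lmo p v) = lmo ((5 / 12 : ℝ) • p -
      (1 / 12 : ℝ) • ∑ i : Fin 7, e i.succ * p * e i.succ) v := by
    rw [sub_eq_add_neg, lmo_add, lmo_neg, lmo_smul, lmo_smul, lmo_sum]
    simp only [reO, sub_apply, smul_apply,
      sum_apply, ContinuousLinearMap.comp_apply, ContinuousLinearMap.id_apply,
      lmo_lmo_of_mem hv, rmo_lmo_of_mem hv, ← sub_eq_add_neg]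
  rw [h, Oct.real_part_formula, lmo_smul, lmo_one]
  rfl

lemma reO_rmo_of_mem (hv : v ∈ ReSet V) (p : Oct) : reO V (rmo p v) = re p • v := by
  rw [rmo_of_mem hv, reO_lmo_of_mem hv]

end ReSetLemmas

lemma reO_rmo_rmo (p q : Oct) (x : V) : reO V (rmo q (rmo p x)) = reO V (rmo (p * q) x) := by
  suffices h : (reO V).comp ((rmo q).comp (rmo p)) = (reO V).comp (rmo (p * q)) from
    DFunLike.congr_fun h x
  refine clm_ext_of_reSet fun r v hv => ?_
  simp only [ContinuousLinearMap.comp_apply, rmo_lmo_of_mem hv, reO_lmo_of_mem hv, re_mul_assoc]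

lemma reO_rmo_lmo (p q : Oct) (x : V) : reO V (rmo q (lmo p x)) = reO V (rmo p (rmo q x)) := by
  suffices h : (reO V).comp ((rmo q).comp (lmo p)) = (reO V).comp ((rmo p).comp (rmo q)) from
    DFunLike.congr_fun h x
  refine clm_ext_of_reSet fun r v hv => ?_
  simp only [ContinuousLinearMap.comp_apply, rmo_lmo_of_mem hv, lmo_lmo_of_mem hv,
    reO_lmo_of_mem hv]
  rw [re_mul_assoc, re_mul_comm]

lemma sum_rmo_reO (x : V) : ∑ i, rmo (e i) (reO V (rmo (conj (e i)) x)) = x := by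
  suffices h : ∑ i, (rmo (e i)).comp ((reO V).comp (rmo (conj (e i)))) = 1 by
    have := DFunLike.congr_fun h x
    simpa using this
  refine clm_ext_of_reSet fun p v hv => ?_
  simp only [sum_apply, ContinuousLinearMap.comp_apply, rmo_lmo_of_mem hv,
    reO_lmo_of_mem hv, re_mul_conj_e, map_smul, rmo_of_mem hv, one_apply_eq_self]
  conv_rhs => rw [← sum_coord_smul_e p]
  simp only [lmo_sum, lmo_smul, sum_apply, smul_apply]

lemma eq_of_reO_rmo {x y : V} (h : ∀ q, reO V (rmo q x) = reO V (rmo q y)) : x = y := by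
  rw [← sum_rmo_reO x, ← sum_rmo_reO y]
  simp only [h]

lemma clm_ext_of_rmo {W : Type*} [NormedAddCommGroup W] [NormedSpace ℝ W] {A B : V →L[ℝ] W}
    (h : ∀ p, ∀ v ∈ ReSet V, A (rmo p v) = B (rmo p v)) : A = B :=
  clm_ext_of_reSet fun p v hv => by rw [← rmo_of_mem hv, h p v hv]

lemma IsRightPara.reO_rmo {T : V →L[ℝ] V} (hT : IsRightPara T) (q : Oct) (x : V) :
    reO V (rmo q (T x)) = reO V (T (rmo q x)) := by
  have h := hT q x
  rw [Bop, sub_apply, map_sub, sub_eq_zero] at h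
  exact h

lemma IsRightPara.map_rmo {T : V →L[ℝ] V} (hT : IsRightPara T) {v : V} (hv : v ∈ ReSet V)
    (p : Oct) : T (rmo p v) = rmo p (T v) := by
  refine eq_of_reO_rmo fun q => ?_
  rw [hT.reO_rmo, rmo_rmo_of_mem hv, reO_rmo_rmo, hT.reO_rmo]

end RealPart

section OperatorCauchy

open Filter Set
open scoped Topology

variable {E : Type*} [NormedRing E] [NormedAlgebra ℝ E] [CompleteSpace E] (R : ℂ →ₐ[ℝ] E) (T : E)

lemma continuous_algHom_complex {E : Type*} [NormedRing E] [NormedAlgebra ℝ E] (R : ℂ →ₐ[ℝ] E) :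
    Continuous R :=
  R.toLinearMap.continuous_of_finiteDimensional

/-- The resolvent of `T` with respect to a homomorphism from the complex numbers. -/
def resolventAlong (z : ℂ) : E := Ring.inverse (R z - T)

variable {R T}

lemma continuousAt_resolventAlong {z : ℂ} (hz : IsUnit (R z - T)) :
    ContinuousAt (resolventAlong R T) z := by
  have h : ContinuousAt (fun w => R w - T) z :=
    ((continuous_algHom_complex R).sub continuous_const).continuousAt
  obtain ⟨u, hu⟩ := hz
  have h2 := NormedRing.inverse_continuousAt u
  rw [hu] at h2
  exact ContinuousAt.comp (f := fun w => R w - T) (g := Ring.inverse) h2 h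

lemma tendsto_resolventAlong : Tendsto (resolventAlong R T) (cocompact ℂ) (𝓝 0) := by
  have hinv : Tendsto (fun z : ℂ => z⁻¹) (cocompact ℂ) (𝓝 0) := by
    rw [← Metric.cobounded_eq_cocompact]
    exact tendsto_inv₀_cobounded
  have hR : Tendsto (fun z : ℂ => R z⁻¹) (cocompact ℂ) (𝓝 0) := by
    have := ((continuous_algHom_complex R).tendsto 0).comp hinv
    rwa [map_zero] at this
  have h1 : Tendsto (fun z : ℂ => Ring.inverse (1 - T * R z⁻¹)) (cocompact ℂ) (𝓝 1) := by
    have h2 : Tendsto (fun z : ℂ => 1 - T * R z⁻¹) (cocompact ℂ) (𝓝 (1 : Eˣ)) := by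
      simpa using tendsto_const_nhds.sub (tendsto_const_nhds.mul hR)
    have := (NormedRing.inverse_continuousAt (1 : Eˣ)).tendsto.comp h2
    simpa [Function.comp_def] using this
  have h3 : ∀ᶠ z in cocompact ℂ, R z⁻¹ * Ring.inverse (1 - T * R z⁻¹) = resolventAlong R T z := by
    have h0 : ∀ᶠ z : ℂ in cocompact ℂ, z ≠ 0 := by
      have := (isCompact_singleton (x := (0 : ℂ))).compl_mem_cocompact
      exact this
    filter_upwards [h0] with z hz
    have hu : R z * R z⁻¹ = 1 := by rw [← map_mul, mul_inv_cancel₀ hz, map_one]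
    have hu' : R z⁻¹ * R z = 1 := by rw [← map_mul, inv_mul_cancel₀ hz, map_one]
    have h4 : R z - T = (1 - T * R z⁻¹) * R z := by rw [sub_mul, mul_assoc, hu', one_mul, mul_one]
    have h5 : Ring.inverse (R z) = R z⁻¹ := by
      exact Ring.inverse_unit (⟨R z, R z⁻¹, hu, hu'⟩ : Eˣ)
    rw [resolventAlong, h4, Ring.inverse_mul (Or.inr ⟨⟨R z, R z⁻¹, hu, hu'⟩, rfl⟩), h5]
  refine Tendsto.congr' h3 ?_
  simpa using hR.mul h1

lemma analyticAt_resolventAlong {z : ℂ} (hz : IsUnit (R z - T)) (ℓ : E →L[ℝ] ℂ)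
    (hℓ : ∀ (n : ℕ) (h : ℂ), ℓ ((resolventAlong R T z * R h) ^ n * resolventAlong R T z) =
      h ^ n * ℓ (resolventAlong R T z ^ (n + 1))) :
    AnalyticAt ℂ (fun w => ℓ (resolventAlong R T w)) z := by
  set S := resolventAlong R T z with hS
  let c : ℕ → ℂ := fun n => (-1) ^ n * ℓ (S ^ (n + 1))
  refine ⟨FormalMultilinearSeries.ofScalars ℂ c, hasFPowerSeriesAt_iff.2 ?_⟩
  have hsmall : ∀ᶠ h in 𝓝 (0 : ℂ), ‖-(S * R h)‖ < 1 := by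
    have hc : Continuous fun h => ‖-(S * R h)‖ :=
      (continuous_const.mul (continuous_algHom_complex R)).neg.norm
    refine hc.continuousAt.eventually_lt continuousAt_const ?_
    simp
  filter_upwards [hsmall] with h hh
  have h1 : R (z + h) - T = (R z - T) * (1 - -(S * R h)) := by
    rw [sub_neg_eq_add, mul_add, mul_one, ← mul_assoc, hS, resolventAlong,
      Ring.mul_inverse_cancel _ hz, one_mul, map_add]
    abel
  have h2 : HasSum (fun n => (-(S * R h)) ^ n) (Ring.inverse (1 - -(S * R h))) := by
    rw [NormedRing.inverse_one_sub _ hh]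
    exact (summable_geometric_of_norm_lt_one hh).hasSum
  have h3 : HasSum (fun n => ℓ ((-(S * R h)) ^ n * S)) (ℓ (resolventAlong R T (z + h))) := by
    rw [resolventAlong, h1, Ring.inverse_mul (Or.inl hz)]
    exact (h2.mul_right S).mapL ℓ
  have h5 : (fun n => h ^ n • (FormalMultilinearSeries.ofScalars ℂ c).coeff n) =
      fun n => ℓ ((-(S * R h)) ^ n * S) := by
    funext n
    rw [FormalMultilinearSeries.coeff_ofScalars, neg_pow, mul_assoc, smul_eq_mul]
    have h4 : (-1 : E) ^ n * ((S * R h) ^ n * S) = ((-1 : ℝ) ^ n) • ((S * R h) ^ n * S) := by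
      rw [Algebra.smul_def, map_pow, map_neg, map_one]
    rw [h4, map_smul, hℓ, Complex.real_smul]
    push_cast
    ring
  rw [h5]
  exact h3

theorem sum_integral_resolventAlong_eq {n : ℕ} {γ : Fin n → ℝ → ℂ} {D : Set ℂ}
    (hγ : ∀ i, ContDiff ℝ 1 (γ i)) (hcl : ∀ i, γ i 0 = γ i 1) (hD : IsOpen D)
    (hγD : ∀ i, ∀ t ∈ Icc (0 : ℝ) 1, γ i t ∉ D)
    (hwind : ∀ z ∈ D, (∑ i, ∫ t in (0 : ℝ)..1, deriv (γ i) t / (γ i t - z)) =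
      2 * (Real.pi : ℂ) * Complex.I)
    (hu : ∀ z ∉ D, IsUnit (R z - T)) (ℓ : E →L[ℝ] ℂ)
    (hℓ : ∀ z ∉ D, ∀ (n : ℕ) (h : ℂ),
      ℓ ((resolventAlong R T z * R h) ^ n * resolventAlong R T z) =
        h ^ n * ℓ (resolventAlong R T z ^ (n + 1)))
    (hTℓ : ∀ z ∉ D, ∀ k : ℕ, ℓ (T ^ k * (R z * resolventAlong R T z)) =
      z * ℓ (T ^ k * resolventAlong R T z)) (m : ℕ) :
    (∑ i, ∫ t in (0 : ℝ)..1, ℓ (resolventAlong R T (γ i t)) * γ i t ^ m * deriv (γ i) t) =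
      2 * (Real.pi : ℂ) * Complex.I * ℓ (T ^ m) := by
  have := sum_integral_mul_pow_eq hγ hcl hD hγD hwind
    (a := fun k z => ℓ (T ^ k * resolventAlong R T z)) (b := fun k => ℓ (T ^ k)) ?_ ?_ ?_ m
  · simpa using this
  · intro z hz
    simpa using analyticAt_resolventAlong (hu z hz) ℓ (hℓ z hz)
  · intro k z hz
    have h : R z * resolventAlong R T z = 1 + T * resolventAlong R T z := by
      have := Ring.mul_inverse_cancel _ (hu z hz)
      rw [sub_mul, sub_eq_iff_eq_add] at this
      exact this
    rw [← hTℓ z hz, h, mul_add, mul_one, map_add, pow_succ, mul_assoc]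
  · intro k
    have : Tendsto (fun z => ℓ (T ^ k * resolventAlong R T z)) (cocompact ℂ)
        (𝓝 (ℓ (T ^ k * 0))) :=
      (ℓ.continuous.tendsto _).comp (tendsto_const_nhds.mul tendsto_resolventAlong)
    simpa using this

end OperatorCauchy

section Slices

variable {J : Oct}

lemma toSlice_mem_sliceC (J : Oct) (z : ℂ) : toSlice J z ∈ sliceC J := ⟨z.re, z.im, rfl⟩

lemma toSlice_mul (hJ : J ∈ unitSphere) (z w : ℂ) :
    toSlice J z * toSlice J w = toSlice J (z * w) := by
  have h : J * J = -1 := hJ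
  simp only [toSlice, Oct.add_mul, Oct.mul_add, Oct.smul_mul, Oct.mul_smul, Oct.one_mul,
    Oct.mul_one, h, Complex.mul_re, Complex.mul_im]
  module

lemma toSlice_neg (z : ℂ) : toSlice J (-z) = -toSlice J z := by
  simp only [toSlice, Complex.neg_re, Complex.neg_im]
  module

lemma opow_toSlice (hJ : J ∈ unitSphere) (z : ℂ) (m : ℕ) :
    opow (toSlice J z) m = toSlice J (z ^ m) := by
  induction m with
  | zero => simp [opow, toSlice]
  | succ m ih => rw [opow, ih, toSlice_mul hJ, pow_succ']

lemma toSlice_I : toSlice J Complex.I = J := by simp [toSlice]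

lemma neg_toSlice_mul (hJ : J ∈ unitSphere) (z : ℂ) :
    -(toSlice J z) * J = toSlice J (-(z * Complex.I)) := by
  conv_lhs => rw [← toSlice_I (J := J)]
  rw [toSlice_I, ← toSlice_neg]
  nth_rw 2 [← toSlice_I (J := J)]
  rw [toSlice_mul hJ, neg_mul]

lemma continuous_toSlice (J : Oct) : Continuous (toSlice J) :=
  (Complex.continuous_re.smul continuous_const).add (Complex.continuous_im.smul continuous_const)

lemma sliceC_subset_of_toSlice_mem {J J' : Oct} {z : ℂ} (hz : z.im ≠ 0)
    (h : toSlice J z ∈ sliceC J') : sliceC J ⊆ sliceC J' := by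
  obtain ⟨x, y, hxy⟩ := h
  have hJ : J = (z.im⁻¹ * (x - z.re)) • (1 : Oct) + (z.im⁻¹ * y) • J' := by
    have h1 : z.im • J = (x - z.re) • (1 : Oct) + y • J' := by
      rw [toSlice, ← eq_sub_iff_add_eq'] at hxy
      rw [hxy]
      module
    rw [← inv_smul_smul₀ hz J, h1, smul_add, smul_smul, smul_smul]
  rintro _ ⟨a, b, rfl⟩
  refine ⟨a + b * (z.im⁻¹ * (x - z.re)), b * (z.im⁻¹ * y), ?_⟩
  nth_rw 1 [hJ]
  module

variable {V : Type*} [NormedAddCommGroup V] [NormedSpace ℝ V] [OctBimodule V]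

variable (V) in
/-- Right multiplication by elements of a slice, as an algebra homomorphism. -/
def sliceHom (hJ : J ∈ unitSphere) : ℂ →ₐ[ℝ] (V →L[ℝ] V) :=
  Complex.lift ⟨rmo J, by
    have h : J * J = -1 := hJ
    rw [rmo_mul_self, h, rmo_neg, rmo_one]⟩

lemma sliceHom_apply (hJ : J ∈ unitSphere) (z : ℂ) : sliceHom V hJ z = rmo (toSlice J z) := by
  rw [sliceHom, Complex.lift_apply, Complex.liftAux_apply, toSlice, rmo_add, rmo_smul, rmo_smul,
    rmo_one, Algebra.algebraMap_eq_smul_one]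

lemma sliceHom_mul_apply (hJ : J ∈ unitSphere) (z w : ℂ) (y : V) :
    sliceHom V hJ (z * w) y = sliceHom V hJ z (sliceHom V hJ w y) := by
  rw [map_mul]
  rfl

/-- The complexification of a real functional with respect to a slice. -/
def sliceDual (J : Oct) (φ : V →L[ℝ] ℝ) : V →L[ℝ] ℂ :=
  Complex.ofRealCLM.comp φ - Complex.I • Complex.ofRealCLM.comp (φ.comp (rmo J))

lemma sliceDual_apply (φ : V →L[ℝ] ℝ) (y : V) :
    sliceDual J φ y = φ y - Complex.I * φ (rmo J y) := rfl

lemma sliceDual_apply_re (φ : V →L[ℝ] ℝ) (y : V) : (sliceDual J φ y).re = φ y := by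
  simp [sliceDual_apply]

lemma sliceDual_sliceHom (hJ : J ∈ unitSphere) (φ : V →L[ℝ] ℝ) (z : ℂ) (y : V) :
    sliceDual J φ (sliceHom V hJ z y) = z * sliceDual J φ y := by
  have h : J * J = -1 := hJ
  have h2 : rmo J (rmo J y) = -y := by
    have := DFunLike.congr_fun (rmo_mul_self (V := V) J) y
    rw [h, rmo_neg, rmo_one] at this
    exact this
  rw [sliceHom_apply, toSlice, rmo_add, rmo_smul, rmo_smul, rmo_one]
  apply Complex.ext <;>
    simp [sliceDual_apply, h2]; ring

variable {T S : V →L[ℝ] V}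

lemma CJExtPA.map_sliceHom (hS : CJExtPA J S) (hJ : J ∈ unitSphere) {n : ℕ} (hn : 1 ≤ n) {v : V}
    (hv : v ∈ ReSet V) (z : ℂ) : (S ^ n) (sliceHom V hJ z v) = sliceHom V hJ z ((S ^ n) v) := by
  rw [sliceHom_apply]
  exact hS n hn v hv _ (toSlice_mem_sliceC J z)

lemma CJExtPA.pow_mul_apply (hS : CJExtPA J S) (hJ : J ∈ unitSphere) {v : V} (hv : v ∈ ReSet V)
    (n : ℕ) (h : ℂ) :
    ((S * sliceHom V hJ h) ^ n * S) v = sliceHom V hJ (h ^ n) ((S ^ (n + 1)) v) := by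
  induction n with
  | zero => simp
  | succ n ih =>
    rw [pow_succ' (S * _), mul_assoc, mul_apply_eq_comp, ih,
      mul_apply_eq_comp, ← sliceHom_mul_apply, ← pow_succ',
      ← hS.map_sliceHom hJ (Nat.le_add_left 1 n) hv, ← hS.map_sliceHom hJ (Nat.le_add_left 1 _) hv,
      pow_succ' S (n + 1)]
    rfl

lemma IsPowerAssoc.map_sliceHom (hT : IsPowerAssoc T) (hJ : J ∈ unitSphere) (k : ℕ) {v : V}
    (hv : v ∈ ReSet V) (z : ℂ) : (T ^ k) (sliceHom V hJ z v) = sliceHom V hJ z ((T ^ k) v) := by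
  rw [sliceHom_apply]
  exact (hT k).map_rmo hv _

lemma CJExtPA.pow_sliceHom_inverse (hT : IsPowerAssoc T) (hJ : J ∈ unitSphere) {z : ℂ}
    (hu : IsUnit (sliceHom V hJ z - T)) (hS : CJExtPA J (resolventAlong (sliceHom V hJ) T z))
    {v : V} (hv : v ∈ ReSet V) (k : ℕ) (w : ℂ) :
    (T ^ k) (sliceHom V hJ w (resolventAlong (sliceHom V hJ) T z v)) =
      sliceHom V hJ w ((T ^ k) (resolventAlong (sliceHom V hJ) T z v)) := by
  set S := resolventAlong (sliceHom V hJ) T z with hSdef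
  have hinv (y : V) : sliceHom V hJ z (S y) = y + T (S y) := by
    have := DFunLike.congr_fun (Ring.mul_inverse_cancel _ hu) y
    simp only [mul_apply_eq_comp, sub_apply,
      one_apply_eq_self] at this
    exact sub_eq_iff_eq_add.1 this
  have hSw (w : ℂ) : S (sliceHom V hJ w v) = sliceHom V hJ w (S v) := by
    simpa using hS.map_sliceHom hJ le_rfl hv w
  have hT1 (w : ℂ) : T (sliceHom V hJ w (S v)) = sliceHom V hJ w (T (S v)) := by
    have h1 := hinv (sliceHom V hJ w v)
    rw [hSw, ← sliceHom_mul_apply, mul_comm, sliceHom_mul_apply, hinv v, map_add,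
      add_right_inj] at h1
    exact h1.symm
  induction k generalizing w with
  | zero => simp
  | succ k ih =>
    have hTS : T (S v) = sliceHom V hJ z (S v) - v := by rw [hinv, add_sub_cancel_left]
    rw [pow_succ, mul_apply_eq_comp, mul_apply_eq_comp, hT1, hTS, map_sub,
      map_sub, ← sliceHom_mul_apply, ih, hT.map_sliceHom hJ k hv, map_sub, map_sub, ih,
      sliceHom_mul_apply]

lemma CJLiftPA.reO_sliceHom (hS : CJLiftPA J S) (hJ : J ∈ unitSphere) {n : ℕ} (hn : 1 ≤ n) (y : V)
    (z : ℂ) : reO V ((S ^ n) (sliceHom V hJ z y)) = reO V (sliceHom V hJ z ((S ^ n) y)) := by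
  rw [sliceHom_apply]
  exact hS n hn y _ (toSlice_mem_sliceC J z)

lemma sliceDual_reO_apply_sliceHom (hJ : J ∈ unitSphere) (φ : V →L[ℝ] ℝ) {A : V →L[ℝ] V}
    (hA : ∀ (w : ℂ) (y : V), reO V (A (sliceHom V hJ w y)) = reO V (sliceHom V hJ w (A y)))
    (w : ℂ) (y : V) :
    sliceDual J (φ.comp (reO V)) (A (sliceHom V hJ w y)) =
      w * sliceDual J (φ.comp (reO V)) (A y) := by
  have hI (y : V) : rmo J y = sliceHom V hJ Complex.I y := by rw [sliceHom_apply, toSlice_I]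
  rw [← sliceDual_sliceHom hJ]
  simp only [sliceDual_apply, hI, ContinuousLinearMap.comp_apply]
  rw [hA, ← hA Complex.I, ← sliceHom_mul_apply, hA, sliceHom_mul_apply]

lemma CJLiftPA.sliceDual_pow_mul (hS : CJLiftPA J S) (hJ : J ∈ unitSphere) (φ : V →L[ℝ] ℝ) (y : V)
    (n : ℕ) (h : ℂ) : sliceDual J (φ.comp (reO V)) (((S * sliceHom V hJ h) ^ n * S) y) =
      h ^ n * sliceDual J (φ.comp (reO V)) ((S ^ (n + 1)) y) := by
  suffices key : ∀ (j : ℕ) (y : V),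
      sliceDual J (φ.comp (reO V)) ((S ^ j * (S * sliceHom V hJ h) ^ n) y) =
        h ^ n * sliceDual J (φ.comp (reO V)) ((S ^ (j + n)) y) by
    have := key 0 (S y)
    rw [pow_zero, one_mul, zero_add] at this
    rw [pow_succ S]
    exact this
  induction n with
  | zero => simp
  | succ n ih =>
    intro j y
    have h1 : S ^ j * (S * sliceHom V hJ h) ^ (n + 1) =
        S ^ (j + 1) * (sliceHom V hJ h * (S * sliceHom V hJ h) ^ n) := by
      rw [pow_succ', pow_succ S]
      simp only [mul_assoc]
    rw [h1, mul_apply_eq_comp, mul_apply_eq_comp,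
      sliceDual_reO_apply_sliceHom hJ φ
        (fun w y => hS.reO_sliceHom hJ (Nat.le_add_left 1 j) y w) h,
      ← mul_apply_eq_comp, ih, add_right_comm, add_assoc, pow_succ h, ← mul_assoc,
      mul_comm h]

lemma IsPowerAssoc.reO_sliceHom (hT : IsPowerAssoc T) (hJ : J ∈ unitSphere) (k : ℕ) (w : ℂ)
    (y : V) : reO V ((T ^ k) (sliceHom V hJ w y)) = reO V (sliceHom V hJ w ((T ^ k) y)) := by
  rw [sliceHom_apply]
  exact ((hT k).reO_rmo _ y).symm

end Slices

section PowerFormula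

open Set Filter
open scoped Topology

variable {V : Type*} [NormedAddCommGroup V] [NormedSpace ℝ V] [OctBimodule V]

lemma continuous_lmo : Continuous (lmo : Oct → V →L[ℝ] V) :=
  (OctBimodule.lm : Oct →ₗ[ℝ] V →L[ℝ] V).continuous_of_finiteDimensional

lemma continuous_rmo : Continuous (rmo : Oct → V →L[ℝ] V) :=
  (OctBimodule.rm : Oct →ₗ[ℝ] V →L[ℝ] V).continuous_of_finiteDimensional

lemma continuous_extO : Continuous (extO : (V →L[ℝ] V) → V →L[ℝ] V) :=
  continuous_finsetSum _ fun _ _ => continuous_const.clm_comp (continuous_id.clm_comp continuous_const)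

lemma continuous_lifO : Continuous (lifO : (V →L[ℝ] V) → V →L[ℝ] V) :=
  continuous_finsetSum _ fun _ _ => continuous_const.clm_comp (continuous_id.clm_comp continuous_const)

lemma continuousAt_odotR {X : Type*} [TopologicalSpace X] {f : X → V →L[ℝ] V} {g : X → Oct} {x : X}
    (hf : ContinuousAt f x) (hg : ContinuousAt g x) :
    ContinuousAt (fun y => odotR (f y) (g y)) x := by
  have hl : ContinuousAt (fun y => (lmo (g y) : V →L[ℝ] V)) x := continuous_lmo.continuousAt.comp hg
  have hr : ContinuousAt (fun y => (rmo (g y) : V →L[ℝ] V)) x := continuous_rmo.continuousAt.comp hg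
  exact (hf.clm_comp hl).sub ((hr.clm_comp hf).sub (hf.clm_comp hr))

lemma continuousAt_odotL {X : Type*} [TopologicalSpace X] {f : X → V →L[ℝ] V} {g : X → Oct} {x : X}
    (hf : ContinuousAt f x) (hg : ContinuousAt g x) :
    ContinuousAt (fun y => odotL (g y) (f y)) x := by
  have hl : ContinuousAt (fun y => (lmo (g y) : V →L[ℝ] V)) x := continuous_lmo.continuousAt.comp hg
  have hr : ContinuousAt (fun y => (rmo (g y) : V →L[ℝ] V)) x := continuous_rmo.continuousAt.comp hg
  exact (hl.clm_comp hf).add ((hr.clm_comp hf).sub (hf.clm_comp hr))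

lemma rmo_mul_add_rmo_mul (p q : Oct) :
    (rmo (p * q) + rmo (q * p) : V →L[ℝ] V) = rmo p * rmo q + rmo q * rmo p := by
  have h1 := lmo_mul_sub' (V := V) p q
  have h2 := lmo_mul_sub' (V := V) q p
  have h3 := lmo_mul_sub_alt (V := V) p q
  rw [h1, h2] at h3
  rw [← sub_eq_zero] at h3 ⊢
  rw [← neg_eq_zero, ← h3]
  abel

lemma rmo_mul_add_rmo_mul_apply (p q : Oct) (x : V) :
    rmo (p * q) x + rmo (q * p) x = rmo p (rmo q x) + rmo q (rmo p x) :=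
  DFunLike.congr_fun (rmo_mul_add_rmo_mul p q) x

lemma extO_rmo (G : V →L[ℝ] V) {v : V} (hv : v ∈ ReSet V) (p : Oct) :
    extO G (rmo p v) = rmo p (G v) := by
  simp only [extO, sum_apply, ContinuousLinearMap.comp_apply,
    rmo_rmo_of_mem hv, reO_rmo_of_mem hv, re_mul_conj_e, map_smul]
  conv_rhs => rw [← sum_coord_smul_e p]
  simp only [rmo_sum, rmo_smul, sum_apply, smul_apply]

lemma odotR_extO_rmo (G : V →L[ℝ] V) {v : V} (hv : v ∈ ReSet V) (p q : Oct) :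
    odotR (extO G) p (rmo q v) = rmo q (rmo p (G v)) := by
  have h : lmo p (rmo q v) = rmo (p * q) v := by
    rw [rmo_of_mem hv, lmo_lmo_of_mem hv, rmo_of_mem hv]
  simp only [odotR, Bop, sub_apply, ContinuousLinearMap.comp_apply, h,
    rmo_rmo_of_mem hv, extO_rmo G hv]
  rw [← sub_add, sub_add_eq_add_sub, rmo_mul_add_rmo_mul_apply, add_sub_cancel_left]

lemma Oct.sum_re_mul_smul_conj_e (q : Oct) : ∑ i, re (e i * q) • conj (e i) = q := by
  rw [Fin.sum_univ_eight]
  apply ext_components <;> simp [re, Quaternion.re_mul]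

lemma reO_rmo_lifO (S : V →L[ℝ] V) (q : Oct) (x : V) :
    reO V (rmo q (lifO ((reO V).comp S) x)) = reO V (S (rmo q x)) := by
  simp only [lifO, sum_apply, ContinuousLinearMap.comp_apply, map_sum,
    reO_rmo_rmo, reO_rmo_of_mem (reO_mem _)]
  conv_rhs => rw [← Oct.sum_re_mul_smul_conj_e q]
  simp only [rmo_sum, rmo_smul, sum_apply, smul_apply,
    map_sum, map_smul]

lemma reO_rmo_odotL_lifO (S : V →L[ℝ] V) (p q : Oct) (x : V) :
    reO V (rmo q (odotL p (lifO ((reO V).comp S)) x)) = reO V (S (rmo p (rmo q x))) := by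
  simp only [odotL, Bop, add_apply, sub_apply,
    ContinuousLinearMap.comp_apply, map_add, map_sub, reO_rmo_lmo, reO_rmo_lifO]
  rw [reO_rmo_rmo, reO_rmo_rmo, reO_rmo_lifO, reO_rmo_lifO, add_comm, sub_add_eq_add_sub,
    ← map_add, ← map_add, rmo_mul_add_rmo_mul_apply, map_add, map_add, add_sub_cancel_right]

lemma isClosed_CJExtPA (J : Oct) : IsClosed {S : V →L[ℝ] V | CJExtPA J S} := by
  simp only [CJExtPA, ofPred_forall]
  refine isClosed_iInter fun n => isClosed_iInter fun _ => isClosed_iInter fun v =>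
    isClosed_iInter fun _ => isClosed_iInter fun s => isClosed_iInter fun _ =>
    isClosed_eq ?_ ?_ <;> fun_prop

lemma isClosed_CJLiftPA (J : Oct) : IsClosed {S : V →L[ℝ] V | CJLiftPA J S} := by
  simp only [CJLiftPA, ofPred_forall]
  refine isClosed_iInter fun n => isClosed_iInter fun _ => isClosed_iInter fun v =>
    isClosed_iInter fun s => isClosed_iInter fun _ => isClosed_eq ?_ ?_ <;> fun_prop

variable {J : Oct} {U : Set Oct}

lemma SliceContour.notMem (Γ : SliceContour J U) (hU : IsOpen U) (i : Fin Γ.n) {t : ℝ}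
    (ht : t ∈ Icc (0 : ℝ) 1) : toSlice J (Γ.γ i t) ∉ U := by
  intro h
  have h1 : Γ.γ i t ∈ frontier (toSlice J ⁻¹' U) := Γ.image_eq ▸ mem_iUnion.2 ⟨i, t, ht, rfl⟩
  rw [(hU.preimage (continuous_toSlice J)).frontier_eq] at h1
  exact h1.2 h

variable [CompleteSpace V] {T : V →L[ℝ] V}

lemma resolventAlong_sliceHom_mem (hU : IsAdmissibleDomain U) (hJ : J ∈ unitSphere)
    (Γ : SliceContour J U) {P : Set (V →L[ℝ] V)} (hP : IsClosed P)
    (hu : ∀ z, toSlice J z ∉ U → IsUnit (sliceHom V hJ z - T))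
    (h : ∀ z, toSlice J z ∉ U → z.im ≠ 0 → resolventAlong (sliceHom V hJ) T z ∈ P) {z : ℂ}
    (hz : toSlice J z ∉ U) : resolventAlong (sliceHom V hJ) T z ∈ P := by
  have hcl := mem_closure_compl_im_ne_zero Γ.smooth Γ.closed Γ.jordan
    (hU.isOpen.preimage (continuous_toSlice J)) (hU.slice_conn J hJ).isPreconnected Γ.image_eq hz
  rw [← hP.closure_eq]
  exact (continuousAt_resolventAlong (hu z hz)).continuousWithinAt.mem_closure hcl
    fun w hw => h w hw.1 hw.2

lemma LeftAdmissible.resolvent (hU : LeftAdmissible T U) (hJ : J ∈ unitSphere)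
    (Γ : SliceContour J U) {z : ℂ} (hz : toSlice J z ∉ U) :
    IsUnit (sliceHom V hJ z - T) ∧ CJExtPA J (resolventAlong (sliceHom V hJ) T z) := by
  have key (z : ℂ) (hz : toSlice J z ∉ U) : IsUnit (sliceHom V hJ z - T) ∧
      (z.im ≠ 0 → CJExtPA J (resolventAlong (sliceHom V hJ) T z)) := by
    have h : toSlice J z ∈ pbRes T := by
      by_contra h
      exact hz (hU.2 ⟨mem_univ _, h⟩)
    obtain ⟨J', -, hs, h1, h2⟩ := mem_iUnion₂.1 h
    rw [← sliceHom_apply hJ] at h1 h2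
    exact ⟨h1, fun hi n hn v hv s hsJ => h2 n hn v hv s (sliceC_subset_of_toSlice_mem hi hs hsJ)⟩
  exact ⟨(key z hz).1, resolventAlong_sliceHom_mem hU.1 hJ Γ (isClosed_CJExtPA J)
    (fun z hz => (key z hz).1) (fun z hz => (key z hz).2) hz⟩

lemma RightAdmissible.resolvent (hU : RightAdmissible T U) (hJ : J ∈ unitSphere)
    (Γ : SliceContour J U) {z : ℂ} (hz : toSlice J z ∉ U) :
    IsUnit (sliceHom V hJ z - T) ∧ CJLiftPA J (resolventAlong (sliceHom V hJ) T z) := by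
  have key (z : ℂ) (hz : toSlice J z ∉ U) : IsUnit (sliceHom V hJ z - T) ∧
      (z.im ≠ 0 → CJLiftPA J (resolventAlong (sliceHom V hJ) T z)) := by
    have h : toSlice J z ∈ pfRes T := by
      by_contra h
      exact hz (hU.2 ⟨mem_univ _, h⟩)
    obtain ⟨J', -, hs, h1, h2⟩ := mem_iUnion₂.1 h
    rw [← sliceHom_apply hJ] at h1 h2
    exact ⟨h1, fun hi n hn v s hsJ => h2 n hn v s (sliceC_subset_of_toSlice_mem hi hs hsJ)⟩
  exact ⟨(key z hz).1, resolventAlong_sliceHom_mem hU.1 hJ Γ (isClosed_CJLiftPA J)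
    (fun z hz => (key z hz).1) (fun z hz => (key z hz).2) hz⟩

lemma apply_contourSum_eq (hU : IsAdmissibleDomain U) (hJ : J ∈ unitSphere)
    (Γ : SliceContour J U) (m : ℕ) {Φ : ℂ → ℂ → V →L[ℝ] V}
    (hΦ : ∀ z dz, toSlice J z ∉ U → ContinuousAt (fun p : ℂ × ℂ => Φ p.1 p.2) (z, dz))
    (L : (V →L[ℝ] V) →L[ℝ] ℝ) (ℓ : (V →L[ℝ] V) →L[ℝ] ℂ)
    (hL : ∀ z dz, toSlice J z ∉ U → L (Φ z dz) =
      (-(dz * Complex.I) * z ^ m * ℓ (resolventAlong (sliceHom V hJ) T z)).re)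
    (hu : ∀ z, toSlice J z ∉ U → IsUnit (sliceHom V hJ z - T))
    (hℓ : ∀ z, toSlice J z ∉ U → ∀ (n : ℕ) (h : ℂ),
      ℓ ((resolventAlong (sliceHom V hJ) T z * sliceHom V hJ h) ^ n *
          resolventAlong (sliceHom V hJ) T z) =
        h ^ n * ℓ (resolventAlong (sliceHom V hJ) T z ^ (n + 1)))
    (hTℓ : ∀ z, toSlice J z ∉ U → ∀ k : ℕ,
      ℓ (T ^ k * (sliceHom V hJ z * resolventAlong (sliceHom V hJ) T z)) =
        z * ℓ (T ^ k * resolventAlong (sliceHom V hJ) T z)) :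
    L ((2 * Real.pi)⁻¹ • contourSum Γ Φ) = (ℓ (T ^ m)).re := by
  set R := sliceHom V hJ
  have hD := hU.isOpen.preimage (continuous_toSlice J)
  have hmain := sum_integral_resolventAlong_eq Γ.smooth Γ.closed hD
    (fun i t ht => Γ.notMem hU.isOpen i ht) Γ.winding_inside hu ℓ hℓ hTℓ m
  have hpair (i : Fin Γ.n) : Continuous fun t => (Γ.γ i t, deriv (Γ.γ i) t) :=
    (Γ.smooth i).continuous.prodMk ((Γ.smooth i).continuous_deriv le_rfl)
  have hint (i : Fin Γ.n) : IntervalIntegrable (fun t => Φ (Γ.γ i t) (deriv (Γ.γ i) t))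
      MeasureTheory.volume 0 1 := by
    apply ContinuousOn.intervalIntegrable
    rw [uIcc_of_le zero_le_one]
    exact fun t ht => ((hΦ _ _ (Γ.notMem hU.isOpen i ht)).comp (hpair i).continuousAt
      (f := fun t => (Γ.γ i t, deriv (Γ.γ i) t))).continuousWithinAt
  have hint' (i : Fin Γ.n) : IntervalIntegrable
      (fun t => ℓ (resolventAlong R T (Γ.γ i t)) * Γ.γ i t ^ m * deriv (Γ.γ i) t)
      MeasureTheory.volume 0 1 := by
    apply ContinuousOn.intervalIntegrable
    rw [uIcc_of_le zero_le_one]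
    refine ContinuousOn.mul (ContinuousOn.mul ?_ ((Γ.smooth i).continuous.pow m).continuousOn)
      ((Γ.smooth i).continuous_deriv le_rfl).continuousOn
    exact fun t ht => (ℓ.continuous.continuousAt.comp ((continuousAt_resolventAlong
      (hu _ (Γ.notMem hU.isOpen i ht))).comp
        (Γ.smooth i).continuous.continuousAt)).continuousWithinAt
  have hterm (i : Fin Γ.n) : L (∫ t in (0 : ℝ)..1, Φ (Γ.γ i t) (deriv (Γ.γ i) t)) =
      (-Complex.I * ∫ t in (0 : ℝ)..1,
        ℓ (resolventAlong R T (Γ.γ i t)) * Γ.γ i t ^ m * deriv (Γ.γ i) t).re := by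
    rw [← L.intervalIntegral_comp_comm (hint i), ← intervalIntegral.integral_const_mul,
      ← Complex.reCLM_apply, ← Complex.reCLM.intervalIntegral_comp_comm ((hint' i).const_mul _)]
    refine intervalIntegral.integral_congr fun t ht => ?_
    rw [uIcc_of_le zero_le_one] at ht
    simp only [Complex.reCLM_apply]
    rw [hL _ _ (Γ.notMem hU.isOpen i ht)]
    congr 1
    ring
  rw [map_smul, contourSum, map_sum, Finset.sum_congr rfl fun i _ => hterm i, ← Complex.re_sum,
    ← Finset.mul_sum, hmain]
  have : -Complex.I * (2 * (Real.pi : ℂ) * Complex.I * ℓ (T ^ m)) =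
      ((2 * Real.pi : ℝ) : ℂ) * ℓ (T ^ m) := by
    push_cast
    linear_combination (-2 * (Real.pi : ℂ) * ℓ (T ^ m)) * Complex.I_mul_I
  rw [this, Complex.re_ofReal_mul, smul_eq_mul, inv_mul_cancel_left₀ (by positivity)]

theorem left_contour_power (hT : IsPowerAssoc T) (m : ℕ) (hU : LeftAdmissible T U)
    (hJ : J ∈ unitSphere) (Γ : SliceContour J U) :
    (2 * Real.pi)⁻¹ • contourSum Γ (fun z dz =>
      odotR (rinvR ((rmo (toSlice J z) : V →L[ℝ] V) - T))
        ((-(toSlice J dz) * J) * opow (toSlice J z) m)) = T ^ m := by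
  have hΦ (z dz : ℂ) : odotR (rinvR ((rmo (toSlice J z) : V →L[ℝ] V) - T))
        ((-(toSlice J dz) * J) * opow (toSlice J z) m) =
      odotR (extO (resolventAlong (sliceHom V hJ) T z))
        (toSlice J (-(dz * Complex.I) * z ^ m)) := by
    rw [neg_toSlice_mul hJ, opow_toSlice hJ, toSlice_mul hJ, ← sliceHom_apply hJ]
    rfl
  simp only [hΦ]
  refine clm_ext_of_rmo fun q v hv => (SeparatingDual.eq_iff_forall_dual_eq (R := ℝ)).2 fun φ => ?_
  rw [(hT m).map_rmo hv]
  have := apply_contourSum_eq (T := T) hU.1 hJ Γ m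
    (Φ := fun z dz => odotR (extO (resolventAlong (sliceHom V hJ) T z))
        (toSlice J (-(dz * Complex.I) * z ^ m))) ?_
    (φ.comp (ContinuousLinearMap.apply ℝ V (rmo q v)))
    ((sliceDual J (φ.comp (rmo q))).comp (ContinuousLinearMap.apply ℝ V v)) ?_
    (fun z hz => (hU.resolvent hJ Γ hz).1) ?_ ?_
  · simpa only [ContinuousLinearMap.comp_apply, ContinuousLinearMap.apply_apply,
      sliceDual_apply_re] using this
  · intro z dz hz
    have h1 : ContinuousAt (fun p : ℂ × ℂ => extO (resolventAlong (sliceHom V hJ) T p.1))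
        (z, dz) :=
      continuous_extO.continuousAt.comp
        (ContinuousAt.comp (g := resolventAlong (sliceHom V hJ) T)
          (continuousAt_resolventAlong (hU.resolvent hJ Γ hz).1) continuousAt_fst)
    have h2 : Continuous fun p : ℂ × ℂ => toSlice J (-(p.2 * Complex.I) * p.1 ^ m) :=
      (continuous_toSlice J).comp (by fun_prop)
    exact continuousAt_odotR h1 h2.continuousAt
  · intro z dz hz
    simp only [ContinuousLinearMap.comp_apply, ContinuousLinearMap.apply_apply,
      odotR_extO_rmo _ hv]
    rw [← sliceDual_sliceHom hJ, sliceDual_apply_re, sliceHom_apply]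
    rfl
  · intro z hz n h
    simp only [ContinuousLinearMap.comp_apply, ContinuousLinearMap.apply_apply]
    rw [(hU.resolvent hJ Γ hz).2.pow_mul_apply hJ hv, sliceDual_sliceHom]
  · intro z hz k
    simp only [ContinuousLinearMap.comp_apply, ContinuousLinearMap.apply_apply,
      mul_apply_eq_comp]
    rw [(hU.resolvent hJ Γ hz).2.pow_sliceHom_inverse hT hJ (hU.resolvent hJ Γ hz).1 hv,
      sliceDual_sliceHom]

theorem right_contour_power (hT : IsPowerAssoc T) (m : ℕ) (hU : RightAdmissible T U)
    (hJ : J ∈ unitSphere) (Γ : SliceContour J U) :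
    (2 * Real.pi)⁻¹ • contourSum Γ (fun z dz =>
      odotL (opow (toSlice J z) m * (-(toSlice J dz) * J))
        (rinvL ((rmo (toSlice J z) : V →L[ℝ] V) - T))) = T ^ m := by
  have hΦ (z dz : ℂ) : odotL (opow (toSlice J z) m * (-(toSlice J dz) * J))
        (rinvL ((rmo (toSlice J z) : V →L[ℝ] V) - T)) =
      odotL (toSlice J (-(dz * Complex.I) * z ^ m))
        (lifO ((reO V).comp (resolventAlong (sliceHom V hJ) T z))) := by
    rw [neg_toSlice_mul hJ, opow_toSlice hJ, toSlice_mul hJ, ← sliceHom_apply hJ, mul_comm (z ^ m)]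
    rfl
  simp only [hΦ]
  ext x
  refine eq_of_reO_rmo fun q => (SeparatingDual.eq_iff_forall_dual_eq (R := ℝ)).2 fun φ => ?_
  rw [(hT m).reO_rmo]
  have hS {z : ℂ} (hz : toSlice J z ∉ U) (w : ℂ) (y : V) :=
    sliceDual_reO_apply_sliceHom hJ φ
      (fun w y => (hU.resolvent hJ Γ hz).2.reO_sliceHom hJ le_rfl y w) w y
  simp only [pow_one] at hS
  have := apply_contourSum_eq (T := T) hU.1 hJ Γ m
    (Φ := fun z dz => odotL (toSlice J (-(dz * Complex.I) * z ^ m))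
        (lifO ((reO V).comp (resolventAlong (sliceHom V hJ) T z)))) ?_
    ((φ.comp ((reO V).comp (rmo q))).comp (ContinuousLinearMap.apply ℝ V x))
    ((sliceDual J (φ.comp (reO V))).comp (ContinuousLinearMap.apply ℝ V (rmo q x))) ?_
    (fun z hz => (hU.resolvent hJ Γ hz).1) ?_ ?_
  · simpa only [ContinuousLinearMap.comp_apply, ContinuousLinearMap.apply_apply,
      sliceDual_apply_re] using this
  · intro z dz hz
    have h1 : ContinuousAt (fun p : ℂ × ℂ =>
        lifO ((reO V).comp (resolventAlong (sliceHom V hJ) T p.1))) (z, dz) :=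
      continuous_lifO.continuousAt.comp (continuousAt_const.clm_comp
        (ContinuousAt.comp (g := resolventAlong (sliceHom V hJ) T)
          (continuousAt_resolventAlong (hU.resolvent hJ Γ hz).1) continuousAt_fst))
    have h2 : Continuous fun p : ℂ × ℂ => toSlice J (-(p.2 * Complex.I) * p.1 ^ m) :=
      (continuous_toSlice J).comp (by fun_prop)
    exact continuousAt_odotL h1 h2.continuousAt
  · intro z dz hz
    simp only [ContinuousLinearMap.comp_apply, ContinuousLinearMap.apply_apply,
      reO_rmo_odotL_lifO]
    rw [← hS hz, sliceDual_apply_re, sliceHom_apply]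
    rfl
  · intro z hz n h
    simp only [ContinuousLinearMap.comp_apply, ContinuousLinearMap.apply_apply]
    rw [(hU.resolvent hJ Γ hz).2.sliceDual_pow_mul hJ]
  · intro z hz k
    simp only [ContinuousLinearMap.comp_apply, ContinuousLinearMap.apply_apply,
      mul_apply_eq_comp]
    rw [sliceDual_reO_apply_sliceHom hJ φ fun w y => hT.reO_sliceHom hJ k w y]

end PowerFormula

/-- Let `V` be a Banach `𝕆`-bimodule, `T` a power-associative bounded
right para-linear operator, `m ∈ ℕ`, and `U ⊆ 𝕆` a `T`-left-admissible (resp.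
`T`-right-admissible) domain.  Then for every `J ∈ 𝕊` (with `ds_J = −ds·J`):
`(1/2π) ∫_{∂(U∩ℂ_J)} (R_s − T)^{⊚−} ⊙ (ds_J s^m) = T^m`, and respectively
`(1/2π) ∫_{∂(U∩ℂ_J)} (s^m ds_J) ⊙ (R_s − T)^{−⊚} = T^m`. -/
theorem statement_13 {V : Type*} [NormedAddCommGroup V] [NormedSpace ℝ V] [CompleteSpace V]
    [OctBimodule V] (T : V →L[ℝ] V) (hT : IsRightPara T) (hpa : IsPowerAssoc T) (m : ℕ) :
    (∀ U : Set Oct, LeftAdmissible T U → ∀ J ∈ unitSphere, ∀ Γ : SliceContour J U,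
      (2 * Real.pi)⁻¹ • contourSum Γ (fun z dz =>
          odotR (rinvR ((rmo (Oct.toSlice J z) : V →L[ℝ] V) - T))
            ((-(Oct.toSlice J dz) * J) * Oct.opow (Oct.toSlice J z) m)) = T ^ m) ∧
    (∀ U : Set Oct, RightAdmissible T U → ∀ J ∈ unitSphere, ∀ Γ : SliceContour J U,
      (2 * Real.pi)⁻¹ • contourSum Γ (fun z dz =>
          odotL (Oct.opow (Oct.toSlice J z) m * (-(Oct.toSlice J dz) * J))
            (rinvL ((rmo (Oct.toSlice J z) : V →L[ℝ] V) - T))) = T ^ m) := by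
  exact ⟨fun _ hU _ hJ Γ => left_contour_power hpa m hU hJ Γ,
    fun _ hU _ hJ Γ => right_contour_power hpa m hU hJ Γ⟩
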